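/- Product estimate in Sobolev spaces on a bounded domain: Let Ω be a bounded smooth domain in ℝⁿ, n ≥ 2, let m be a positive integer, α a multi-index with |α| = m, and let 1 ≤ q, r₁, r₂, s₁, s₂ ≤ ∞ satisfy 1/q = 1/r₁ + 1/s₁ = 1/r₂ + 1/s₂. Then there is a positive constant C, depending only on m, q, r₁, r₂, s₁, s₂, n, and Ω, such that for all functions f and g for which the right-hand side is finite: ‖D^α(fg)‖_{L^q(Ω)} ≤ C(‖f‖_{L^{r₁}(Ω)} ‖g‖_{W^{m,s₁}(Ω)} + ‖g‖_{L^{r₂}(Ω)} ‖f‖_{W^{m,s₂}(Ω)}). -/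

import Mathlib

open MeasureTheory Real Set ENNReal NNReal

noncomputable section

/-- Partial derivative in direction `i` for functions on `ℝⁿ`. -/
def pdN {n : ℕ} (i : Fin n) (f : (Fin n → ℝ) → ℝ) : (Fin n → ℝ) → ℝ :=
  fun x => fderiv ℝ f x (Pi.single i 1)

/-- Iterated directional derivative along a list of directions. -/
def Dlist {n : ℕ} (l : List (Fin n)) (f : (Fin n → ℝ) → ℝ) : (Fin n → ℝ) → ℝ :=
  l.foldr pdN f

/-- The derivative `D^α` associated with a multi-index `α`. -/
def Dm {n : ℕ} (α : Fin n → ℕ) (f : (Fin n → ℝ) → ℝ) : (Fin n → ℝ) → ℝ :=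
  Dlist ((List.finRange n).flatMap fun i => List.replicate (α i) i) f

/-- The order `|α|` of a multi-index. -/
def mOrder {n : ℕ} (α : Fin n → ℕ) : ℕ := ∑ i, α i

/-- The `L^q(Ω)` norm (valued in `ℝ≥0∞`; `q = ∞` is allowed). -/
def LqN {n : ℕ} (q : ℝ≥0∞) (Ω : Set (Fin n → ℝ)) (f : (Fin n → ℝ) → ℝ) : ℝ≥0∞ :=
  eLpNorm f q (volume.restrict Ω)

/-- The `W^{m,q}(Ω)` norm. -/
def WNorm {n : ℕ} (m : ℕ) (q : ℝ≥0∞) (Ω : Set (Fin n → ℝ))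
    (f : (Fin n → ℝ) → ℝ) : ℝ≥0∞ :=
  ∑ i ∈ Finset.range (m + 1),
    eLpNorm (fun x => ‖iteratedFDeriv ℝ i f x‖) q (volume.restrict Ω)

/-- A bounded smooth domain in `ℝⁿ`: an open bounded set which is the sublevel
set of a smooth function with nonvanishing gradient on the boundary. -/
def SmoothDomain {n : ℕ} (Ω : Set (Fin n → ℝ)) : Prop :=
  IsOpen Ω ∧ Bornology.IsBounded Ω ∧
    ∃ F : (Fin n → ℝ) → ℝ, ContDiff ℝ (⊤ : ℕ∞) F ∧ Ω = {x | F x < 0} ∧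
      ∀ x ∈ frontier Ω, fderiv ℝ F x ≠ 0

section OneDim

variable {F : Type*} [NormedAddCommGroup F] [NormedSpace ℝ F]

lemma exists_mul_le_integral {g : ℝ → ℝ} (hg : Continuous g) (h0 : ∀ t, 0 ≤ g t) {a b c d : ℝ}
    (hac : a ≤ c) (hcd : c ≤ d) (hdb : d ≤ b) :
    ∃ s ∈ Icc c d, (d - c) * g s ≤ ∫ t in a..b, g t := by
  obtain ⟨s, hs, hmin⟩ := isCompact_Icc.exists_isMinOn (nonempty_Icc.2 hcd) hg.continuousOn
  refine ⟨s, hs, ?_⟩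
  calc (d - c) * g s = ∫ t in c..d, g s := by simp
    _ ≤ ∫ t in c..d, g t :=
      intervalIntegral.integral_mono_on hcd (by simp) (hg.intervalIntegrable _ _)
        fun t ht => hmin ht
    _ ≤ ∫ t in a..b, g t :=
      intervalIntegral.integral_mono_interval hac hcd hdb (.of_forall h0)
        (hg.intervalIntegrable _ _)

lemma norm_sub_le_integral_norm_deriv [CompleteSpace F] {v v' : ℝ → F}
    (hv : ∀ t, HasDerivAt v (v' t) t) (hv' : Continuous v') {a b x y : ℝ}
    (hx : x ∈ Icc a b) (hy : y ∈ Icc a b) :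
    ‖v y - v x‖ ≤ ∫ t in a..b, ‖v' t‖ := by
  wlog hxy : x ≤ y generalizing x y
  · rw [norm_sub_rev]; exact this hy hx (le_of_not_ge hxy)
  rw [← intervalIntegral.integral_eq_sub_of_hasDerivAt (fun t _ => hv t)
    (hv'.intervalIntegrable _ _)]
  refine (intervalIntegral.norm_integral_le_integral_norm hxy).trans ?_
  exact intervalIntegral.integral_mono_interval hx.1 hxy hy.2 (.of_forall fun t => norm_nonneg _)
    (hv'.norm.intervalIntegrable _ _)

lemma norm_le_integral_norm_add_integral_norm_deriv [CompleteSpace F] {v v' : ℝ → F}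
    (hv : ∀ t, HasDerivAt v (v' t) t) (hv' : Continuous v') {c x : ℝ} (hx : x ∈ Icc c (c + 1)) :
    ‖v x‖ ≤ (∫ t in c..c + 1, ‖v t‖) + ∫ t in c..c + 1, ‖v' t‖ := by
  have hc : Continuous v := continuous_iff_continuousAt.2 fun t => (hv t).continuousAt
  obtain ⟨s, hs, h⟩ := exists_mul_le_integral hc.norm (fun t => norm_nonneg _) le_rfl
    (by linarith : c ≤ c + 1) le_rfl
  have h1 := norm_sub_le_integral_norm_deriv hv hv' hs hx
  have h2 := norm_le_insert' (v x) (v s)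
  linarith

lemma norm_deriv_le_integral [CompleteSpace F] {v v' v'' : ℝ → F}
    (hv : ∀ t, HasDerivAt v (v' t) t) (hv' : ∀ t, HasDerivAt v' (v'' t) t)
    (hv'' : Continuous v'') {a b y : ℝ} (hab : a < b) (hy : y ∈ Icc a b) :
    ‖v' y‖ ≤ 18 / (b - a) ^ 2 * (∫ t in a..b, ‖v t‖) + ∫ t in a..b, ‖v'' t‖ := by
  have hc : Continuous v := continuous_iff_continuousAt.2 fun t => (hv t).continuousAt
  set d := b - a with hd
  have hd0 : 0 < d := by linarith
  obtain ⟨s₁, hs₁, h₁⟩ := exists_mul_le_integral (a := a) (b := b) (c := a) (d := a + d / 3)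
    hc.norm (fun t => norm_nonneg _) le_rfl (by linarith) (by linarith)
  obtain ⟨s₂, hs₂, h₂⟩ := exists_mul_le_integral (a := a) (b := b) (c := b - d / 3) (d := b)
    hc.norm (fun t => norm_nonneg _) (by linarith) (by linarith) le_rfl
  set I := ∫ t in a..b, ‖v t‖
  set M := ∫ t in a..b, ‖v'' t‖
  have key : ‖(v s₂ - s₂ • v' y) - (v s₁ - s₁ • v' y)‖ ≤ M * ‖s₂ - s₁‖ := by
    refine (convex_Icc a b).norm_image_sub_le_of_norm_hasDerivWithin_le
      (f := fun t => v t - t • v' y) (f' := fun t => v' t - (1 : ℝ) • v' y)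
      (fun t _ => ((hv t).sub ((hasDerivAt_id t).smul_const (v' y))).hasDerivWithinAt)
      (fun t ht => ?_) ⟨hs₁.1, by linarith [hs₁.2]⟩ ⟨by linarith [hs₂.1], hs₂.2⟩
    rw [one_smul]
    exact norm_sub_le_integral_norm_deriv hv' hv'' hy ht
  have hs : d / 3 ≤ s₂ - s₁ := by linarith [hs₁.2, hs₂.1]
  have hs0 : 0 < s₂ - s₁ := by linarith
  rw [Real.norm_of_nonneg hs0.le] at key
  have e : (s₂ - s₁) • v' y = (v s₂ - v s₁) -
      ((v s₂ - s₂ • v' y) - (v s₁ - s₁ • v' y)) := by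
    rw [sub_smul]; abel
  have h3 : (s₂ - s₁) * ‖v' y‖ ≤ ‖v s₂‖ + ‖v s₁‖ + M * (s₂ - s₁) := by
    rw [← Real.norm_of_nonneg hs0.le, ← norm_smul, e, Real.norm_of_nonneg hs0.le]
    exact (norm_sub_le _ _).trans (add_le_add (norm_sub_le _ _) key)
  have h4 : (s₂ - s₁) * (‖v' y‖ - M) ≤ 6 * I / d := by
    rw [le_div_iff₀ hd0]
    nlinarith
  have h5 : ‖v' y‖ - M ≤ 18 / d ^ 2 * I := by
    by_cases hn : ‖v' y‖ - M ≤ 0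
    · refine hn.trans ?_
      have : 0 ≤ I := intervalIntegral.integral_nonneg hab.le fun t _ => norm_nonneg _
      positivity
    · have h6 : d / 3 * (‖v' y‖ - M) ≤ 6 * I / d :=
        (mul_le_mul_of_nonneg_right hs (le_of_not_ge hn)).trans h4
      have : ‖v' y‖ - M = 3 / d * (d / 3 * (‖v' y‖ - M)) := by field_simp
      rw [this]
      calc _ ≤ 3 / d * (6 * I / d) := by gcongr
        _ = _ := by field_simp; ring
  linarith

lemma integral_rpow_le {H : ℝ → ℝ} (hH : Continuous H) (hH0 : ∀ t, 0 ≤ H t) {a b ρ : ℝ}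
    (hab : a ≤ b) (hρ0 : 0 ≤ ρ) (hρ1 : ρ ≤ 1) :
    ∫ t in a..b, H t ^ ρ ≤ (b - a) ^ (1 - ρ) * (∫ t in a..b, H t) ^ ρ := by
  have hc : Continuous fun t => H t ^ ρ := hH.rpow_const fun _ => Or.inr hρ0
  have hI : 0 ≤ ∫ t in a..b, H t := intervalIntegral.integral_nonneg hab fun t _ => hH0 t
  have hba : 0 ≤ b - a := by linarith
  rw [← ENNReal.ofReal_le_ofReal_iff (by positivity), ENNReal.ofReal_mul (by positivity),
    ← ENNReal.ofReal_rpow_of_nonneg hI hρ0, ← ENNReal.ofReal_rpow_of_nonneg hba (by linarith),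
    intervalIntegral.integral_of_le hab, intervalIntegral.integral_of_le hab,
    ofReal_integral_eq_lintegral_ofReal
      ((hc.intervalIntegrable a b).1) (.of_forall fun t => Real.rpow_nonneg (hH0 t) _),
    ofReal_integral_eq_lintegral_ofReal ((hH.intervalIntegrable a b).1) (.of_forall hH0)]
  have := ENNReal.lintegral_mul_norm_pow_le (μ := volume.restrict (Ioc a b))
    (f := fun _ => 1) (g := fun t => ENNReal.ofReal (H t)) (p := 1 - ρ) (q := ρ)
    aemeasurable_const hH.measurable.ennreal_ofReal.aemeasurable (by linarith) hρ0 (by ring)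
  simpa [ENNReal.ofReal_rpow_of_nonneg (hH0 _) hρ0] using this

lemma norm_deriv_le_of_window [CompleteSpace F] {v v' v'' : ℝ → F}
    (hv : ∀ t, HasDerivAt v (v' t) t) (hv' : ∀ t, HasDerivAt v' (v'' t) t)
    (hv'' : Continuous v'') {a b y ℓ K L ρ τ : ℝ} {H W : ℝ → ℝ}
    (hH : Continuous H) (hH0 : ∀ t, 0 ≤ H t) (hW : Continuous W) (hW0 : ∀ t, 0 ≤ W t)
    (hK : 0 ≤ K) (hL : 0 ≤ L) (hρ0 : 0 ≤ ρ) (hρ1 : ρ ≤ 1) (hτ0 : 0 ≤ τ) (hτ1 : τ ≤ 1)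
    (h₁ : ∀ t ∈ Icc a b, ‖v t‖ ≤ K * H t ^ ρ) (h₂ : ∀ t ∈ Icc a b, ‖v'' t‖ ≤ L * W t ^ τ)
    (hℓ : 0 < ℓ) (hab : ℓ ≤ b - a) (hab' : b - a ≤ 2 * ℓ) (hy : y ∈ Icc a b) :
    ‖v' y‖ ≤ 36 * ℓ ^ (-1 - ρ) * (K * (∫ t in a..b, H t) ^ ρ) +
      2 * ℓ ^ (1 - τ) * (L * (∫ t in a..b, W t) ^ τ) := by
  have hlt : a < b := by linarith
  have hd : 0 < b - a := by linarith
  have aux : ∀ {u : ℝ → F} {G : ℝ → ℝ} {M σ : ℝ}, Continuous u → Continuous G →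
      (∀ t, 0 ≤ G t) → 0 ≤ M → 0 ≤ σ → σ ≤ 1 → (∀ t ∈ Icc a b, ‖u t‖ ≤ M * G t ^ σ) →
      ∫ t in a..b, ‖u t‖ ≤ 2 * ℓ ^ (1 - σ) * (M * (∫ t in a..b, G t) ^ σ) := by
    intro u G M σ hu hG hG0 hM hσ0 hσ1 hle
    have hI : 0 ≤ ∫ t in a..b, G t := intervalIntegral.integral_nonneg hlt.le fun t _ => hG0 t
    have hc : Continuous fun t => G t ^ σ := hG.rpow_const fun _ => Or.inr hσ0
    have h2 : (b - a) ^ (1 - σ) ≤ 2 * ℓ ^ (1 - σ) := by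
      calc (b - a) ^ (1 - σ) ≤ (2 * ℓ) ^ (1 - σ) :=
            Real.rpow_le_rpow hd.le hab' (by linarith)
        _ = 2 ^ (1 - σ) * ℓ ^ (1 - σ) := Real.mul_rpow (by norm_num) hℓ.le
        _ ≤ 2 * ℓ ^ (1 - σ) := by
          gcongr
          calc (2 : ℝ) ^ (1 - σ) ≤ 2 ^ (1 : ℝ) :=
                Real.rpow_le_rpow_of_exponent_le (by norm_num) (by linarith)
            _ = 2 := Real.rpow_one 2
    calc ∫ t in a..b, ‖u t‖ ≤ ∫ t in a..b, M * G t ^ σ :=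
          intervalIntegral.integral_mono_on hlt.le (hu.norm.intervalIntegrable _ _)
            ((continuous_const.mul hc).intervalIntegrable _ _) hle
      _ = M * ∫ t in a..b, G t ^ σ := intervalIntegral.integral_const_mul _ _
      _ ≤ M * ((b - a) ^ (1 - σ) * (∫ t in a..b, G t) ^ σ) := by
          gcongr
          exact integral_rpow_le hG hG0 hlt.le hσ0 hσ1
      _ ≤ M * ((2 * ℓ ^ (1 - σ)) * (∫ t in a..b, G t) ^ σ) := by gcongr
      _ = _ := by ring
  have hvc : Continuous v := continuous_iff_continuousAt.2 fun t => (hv t).continuousAt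
  have e₁ := aux hvc hH hH0 hK hρ0 hρ1 h₁
  have e₂ := aux hv'' hW hW0 hL hτ0 hτ1 h₂
  have hI : 0 ≤ K * (∫ t in a..b, H t) ^ ρ :=
    mul_nonneg hK (Real.rpow_nonneg
      (intervalIntegral.integral_nonneg hlt.le fun t _ => hH0 t) _)
  refine (norm_deriv_le_integral hv hv' hv'' hlt hy).trans (add_le_add ?_ e₂)
  calc 18 / (b - a) ^ 2 * (∫ t in a..b, ‖v t‖)
      ≤ 18 / ℓ ^ 2 * (2 * ℓ ^ (1 - ρ) * (K * (∫ t in a..b, H t) ^ ρ)) := by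
        have : 0 ≤ ∫ t in a..b, ‖v t‖ :=
          intervalIntegral.integral_nonneg hlt.le fun t _ => norm_nonneg (v t)
        gcongr
    _ = 36 * (ℓ ^ (1 - ρ) / ℓ ^ 2) * (K * (∫ t in a..b, H t) ^ ρ) := by ring
    _ = _ := by
      rw [← Real.rpow_natCast ℓ 2, ← Real.rpow_sub hℓ]
      congr 3
      push_cast; ring

lemma exists_balanced_scale [CompleteSpace F] {v v' v'' : ℝ → F}
    (hv : ∀ t, HasDerivAt v (v' t) t) (hv' : ∀ t, HasDerivAt v' (v'' t) t)
    (hv'' : Continuous v'') {c x K L ρ τ : ℝ} {H W : ℝ → ℝ}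
    (hH : Continuous H) (hH0 : ∀ t, 0 ≤ H t) (hW : Continuous W) (hW0 : ∀ t, 0 ≤ W t)
    (hK : 0 ≤ K) (hL : 0 ≤ L) (hρ0 : 0 ≤ ρ) (hρ1 : ρ ≤ 1) (hτ0 : 0 ≤ τ) (hτ1 : τ ≤ 1)
    (h₁ : ∀ t ∈ Icc c (c + 1), ‖v t‖ ≤ K * H t ^ ρ)
    (h₂ : ∀ t ∈ Icc c (c + 1), ‖v'' t‖ ≤ L * W t ^ τ)
    (h₃ : K * (∫ t in c..c + 1, H t) ^ ρ ≤ L * (∫ t in c..c + 1, W t) ^ τ)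
    (hx : x ∈ Icc c (c + 1)) (hx0 : v' x ≠ 0) :
    ∃ ℓ : ℝ, 0 < ℓ ∧ ℓ ≤ 1 ∧ ∀ y ∈ Icc (max c (x - ℓ)) (min (c + 1) (x + ℓ)),
      ‖v' y‖ ^ 2 ≤ 1444 * ℓ ^ (-(ρ + τ)) *
        (K * (∫ t in max c (x - ℓ)..min (c + 1) (x + ℓ), H t) ^ ρ) *
        (L * (∫ t in max c (x - ℓ)..min (c + 1) (x + ℓ), W t) ^ τ) := by
  obtain ⟨hx1, hx2⟩ := hx
  set A : ℝ → ℝ := fun ℓ => K * (∫ t in max c (x - ℓ)..min (c + 1) (x + ℓ), H t) ^ ρ with hA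
  set B : ℝ → ℝ := fun ℓ => L * (∫ t in max c (x - ℓ)..min (c + 1) (x + ℓ), W t) ^ τ with hB
  have hcont : ∀ {G : ℝ → ℝ} {M σ : ℝ}, Continuous G → 0 ≤ σ → Continuous fun ℓ =>
      M * (∫ t in max c (x - ℓ)..min (c + 1) (x + ℓ), G t) ^ σ := by
    intro G M σ hG hσ
    have hp := intervalIntegral.continuous_primitive
      (fun a b => hG.intervalIntegrable (μ := volume) a b) 0
    have e : (fun ℓ => ∫ t in max c (x - ℓ)..min (c + 1) (x + ℓ), G t) = fun ℓ =>
        (∫ t in (0 : ℝ)..min (c + 1) (x + ℓ), G t) - ∫ t in (0 : ℝ)..max c (x - ℓ), G t := by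
      ext ℓ
      rw [intervalIntegral.integral_interval_sub_left] <;> exact hG.intervalIntegrable _ _
    refine continuous_const.mul (Continuous.rpow_const ?_ fun _ => Or.inr hσ)
    rw [e]
    exact (hp.comp (by fun_prop : Continuous fun ℓ => min (c + 1) (x + ℓ))).sub
      (hp.comp (by fun_prop : Continuous fun ℓ => max c (x - ℓ)))
  have hAc : Continuous A := hcont hH hρ0
  have hBc : Continuous B := hcont hW hτ0
  have hgeo : ∀ ℓ, 0 < ℓ → ℓ ≤ 1 → ℓ ≤ min (c + 1) (x + ℓ) - max c (x - ℓ) ∧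
      min (c + 1) (x + ℓ) - max c (x - ℓ) ≤ 2 * ℓ := by
    intro ℓ h0 h1
    rcases max_cases c (x - ℓ) with h | h <;> rcases min_cases (c + 1) (x + ℓ) with h' | h' <;>
      constructor <;> linarith
  have hbound : ∀ ℓ, 0 < ℓ → ℓ ≤ 1 → ∀ y ∈ Icc (max c (x - ℓ)) (min (c + 1) (x + ℓ)),
      ‖v' y‖ ≤ 36 * ℓ ^ (-1 - ρ) * A ℓ + 2 * ℓ ^ (1 - τ) * B ℓ := by
    intro ℓ h0 h1 y hy
    have hsub : Icc (max c (x - ℓ)) (min (c + 1) (x + ℓ)) ⊆ Icc c (c + 1) :=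
      Icc_subset_Icc (le_max_left _ _) (min_le_left _ _)
    exact norm_deriv_le_of_window hv hv' hv'' hH hH0 hW hW0 hK hL hρ0 hρ1 hτ0 hτ1
      (fun t ht => h₁ t (hsub ht)) (fun t ht => h₂ t (hsub ht)) h0 (hgeo ℓ h0 h1).1
      (hgeo ℓ h0 h1).2 hy
  have hA0 : ∀ ℓ, 0 < ℓ → ℓ ≤ 1 → 0 ≤ A ℓ := fun ℓ h0 h1 =>
    mul_nonneg hK (Real.rpow_nonneg (intervalIntegral.integral_nonneg
      (by linarith [(hgeo ℓ h0 h1).1]) fun t _ => hH0 t) _)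
  have hB0 : ∀ ℓ, 0 < ℓ → ℓ ≤ 1 → 0 ≤ B ℓ := fun ℓ h0 h1 =>
    mul_nonneg hL (Real.rpow_nonneg (intervalIntegral.integral_nonneg
      (by linarith [(hgeo ℓ h0 h1).1]) fun t _ => hW0 t) _)
  have hbal : ∃ ℓ, 0 < ℓ ∧ ℓ ≤ 1 ∧ A ℓ = ℓ ^ (2 + ρ - τ) * B ℓ := by
    by_contra! hne
    have hφ : Continuous fun ℓ : ℝ => A ℓ - ℓ ^ (2 + ρ - τ) * B ℓ :=
      hAc.sub ((Real.continuous_rpow_const (by linarith)).mul hBc)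
    have h1 : A 1 - 1 ^ (2 + ρ - τ) * B 1 ≤ 0 := by
      rw [Real.one_rpow, one_mul, sub_nonpos]
      simp only [hA, hB]
      rw [max_eq_left (by linarith), min_eq_left (by linarith)]
      exact h₃
    have hneg : ∀ ℓ, 0 < ℓ → ℓ ≤ 1 → A ℓ ≤ ℓ ^ (2 + ρ - τ) * B ℓ := by
      intro ℓ h0 hℓ1
      by_contra! hlt
      obtain ⟨z, hz, hz0⟩ := intermediate_value_Icc' hℓ1 hφ.continuousOn
        ⟨h1, (sub_pos.2 hlt).le⟩
      exact hne z (by linarith [hz.1]) hz.2 (sub_eq_zero.1 hz0)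
    have hle : ∀ ℓ, 0 < ℓ → ℓ ≤ 1 → ‖v' x‖ ≤ 38 * (ℓ ^ (1 - τ) * B ℓ) := by
      intro ℓ h0 hℓ1
      refine (hbound ℓ h0 hℓ1 x ⟨max_le hx1 (by linarith), le_min hx2 (by linarith)⟩).trans ?_
      have := mul_le_mul_of_nonneg_left (hneg ℓ h0 hℓ1)
        (by positivity : 0 ≤ 36 * ℓ ^ (-1 - ρ))
      have e : ℓ ^ (-1 - ρ) * ℓ ^ (2 + ρ - τ) = ℓ ^ (1 - τ) := by
        rw [← Real.rpow_add h0]; congr 1; ring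
      calc _ ≤ 36 * ℓ ^ (-1 - ρ) * (ℓ ^ (2 + ρ - τ) * B ℓ) + 2 * ℓ ^ (1 - τ) * B ℓ := by gcongr
        _ = 36 * (ℓ ^ (-1 - ρ) * ℓ ^ (2 + ρ - τ)) * B ℓ + 2 * ℓ ^ (1 - τ) * B ℓ := by ring
        _ = _ := by rw [e]; ring
    have hlim : Filter.Tendsto (fun ℓ : ℝ => 38 * (ℓ ^ (1 - τ) * B ℓ)) (nhdsWithin 0 (Ioi 0))
        (nhds (38 * ((0 : ℝ) ^ (1 - τ) * B 0))) :=
      ((continuous_const.mul ((Real.continuous_rpow_const (by linarith)).mul hBc)).tendsto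
        (0 : ℝ)).mono_left nhdsWithin_le_nhds
    have hzero : (0 : ℝ) ^ (1 - τ) * B 0 = 0 := by
      rcases hτ1.eq_or_lt with h | h
      · simp [hB, h, max_eq_right hx1, min_eq_right hx2]
      · rw [Real.zero_rpow (by linarith), zero_mul]
    rw [hzero, mul_zero] at hlim
    have : ‖v' x‖ ≤ 0 := by
      refine ge_of_tendsto hlim ?_
      filter_upwards [Ioc_mem_nhdsGT (zero_lt_one' ℝ)] with ℓ hℓ using hle ℓ hℓ.1 hℓ.2
    exact hx0 (norm_le_zero_iff.1 this)
  obtain ⟨ℓ, h0, hℓ1, heq⟩ := hbal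
  refine ⟨ℓ, h0, hℓ1, fun y hy => ?_⟩
  have hb := hbound ℓ h0 hℓ1 y hy
  have e : ℓ ^ (-1 - ρ) * ℓ ^ (2 + ρ - τ) = ℓ ^ (1 - τ) := by
    rw [← Real.rpow_add h0]; congr 1; ring
  have e' : ℓ ^ (1 - τ) * ℓ ^ (1 - τ) = ℓ ^ (-(ρ + τ)) * ℓ ^ (2 + ρ - τ) := by
    rw [← Real.rpow_add h0, ← Real.rpow_add h0]; congr 1; ring
  have hb' : ‖v' y‖ ≤ 38 * (ℓ ^ (1 - τ) * B ℓ) := by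
    rw [heq] at hb
    calc _ ≤ _ := hb
      _ = 36 * (ℓ ^ (-1 - ρ) * ℓ ^ (2 + ρ - τ)) * B ℓ + 2 * ℓ ^ (1 - τ) * B ℓ := by ring
      _ = _ := by rw [e]; ring
  calc ‖v' y‖ ^ 2 ≤ (38 * (ℓ ^ (1 - τ) * B ℓ)) ^ 2 := by gcongr
    _ = 1444 * (ℓ ^ (1 - τ) * ℓ ^ (1 - τ)) * B ℓ * B ℓ := by ring
    _ = 1444 * ℓ ^ (-(ρ + τ)) * (ℓ ^ (2 + ρ - τ) * B ℓ) * B ℓ := by rw [e']; ring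
    _ = 1444 * ℓ ^ (-(ρ + τ)) * A ℓ * B ℓ := by rw [heq]

lemma tsum_mul_rpow_le {ι : Type*} (a b : ι → ℝ≥0∞) {p q : ℝ} (hp : 0 ≤ p) (hq : 0 ≤ q)
    (hpq : p + q = 1) :
    ∑' i, a i ^ p * b i ^ q ≤ (∑' i, a i) ^ p * (∑' i, b i) ^ q := by
  let : MeasurableSpace ι := ⊤
  simpa [lintegral_count] using ENNReal.lintegral_mul_norm_pow_le (μ := Measure.count)
    (f := a) (g := b) measurable_from_top.aemeasurable measurable_from_top.aemeasurable hp hq hpq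

lemma ofReal_intervalIntegral_eq_setLIntegral {G : ℝ → ℝ} (hG : Continuous G)
    (hG0 : ∀ t, 0 ≤ G t) {a b : ℝ} (hab : a ≤ b) :
    ENNReal.ofReal (∫ t in a..b, G t) = ∫⁻ t in Icc a b, ENNReal.ofReal (G t) := by
  rw [intervalIntegral.integral_of_le hab, ofReal_integral_eq_lintegral_ofReal
    ((hG.intervalIntegrable a b).1) (.of_forall hG0), Measure.restrict_congr_set Ioc_ae_eq_Icc]

lemma setLIntegral_rpow_le_of_sq_le {V : Type*} [NormedAddCommGroup V] {u : ℝ → V} {H W : ℝ → ℝ} {a b ℓ p K L ρ τ : ℝ}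
    (hH : Continuous H) (hH0 : ∀ t, 0 ≤ H t) (hW : Continuous W) (hW0 : ∀ t, 0 ≤ W t)
    (hp : 0 < p) (hpρτ : p * (ρ + τ) = 2)
    (hK : 0 ≤ K) (hL : 0 ≤ L) (hρ0 : 0 ≤ ρ) (hτ0 : 0 ≤ τ)
    (hℓ : 0 < ℓ) (hab : a ≤ b) (hab' : b - a ≤ 2 * ℓ)
    (h : ∀ y ∈ Icc a b, ‖u y‖ ^ 2 ≤ 1444 * ℓ ^ (-(ρ + τ)) *
        (K * (∫ t in a..b, H t) ^ ρ) * (L * (∫ t in a..b, W t) ^ τ)) :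
    ∫⁻ t in Icc a b, ‖u t‖ₑ ^ p ≤ ENNReal.ofReal (2 * 1444 ^ (p / 2)) *
      ENNReal.ofReal (K * L) ^ (p / 2) *
      ((∫⁻ t in Icc a b, ENNReal.ofReal (H t)) ^ (p * ρ / 2) *
      (∫⁻ t in Icc a b, ENNReal.ofReal (W t)) ^ (p * τ / 2)) := by
  have hIH : 0 ≤ ∫ t in a..b, H t := intervalIntegral.integral_nonneg hab fun t _ => hH0 t
  have hIW : 0 ≤ ∫ t in a..b, W t := intervalIntegral.integral_nonneg hab fun t _ => hW0 t
  rw [← ofReal_intervalIntegral_eq_setLIntegral hH hH0 hab,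
    ← ofReal_intervalIntegral_eq_setLIntegral hW hW0 hab]
  set μ := ∫ t in a..b, H t
  set ν := ∫ t in a..b, W t
  set M := 1444 ^ (p / 2) * ℓ⁻¹ * (K * L) ^ (p / 2) * (μ ^ (p * ρ / 2) * ν ^ (p * τ / 2)) with hM
  have hM0 : 0 ≤ M := by positivity
  have hpt : ∀ y ∈ Icc a b, ‖u y‖ₑ ^ p ≤ ENNReal.ofReal M := by
    intro y hy
    rw [← ofReal_norm, ENNReal.ofReal_rpow_of_nonneg (norm_nonneg _) hp.le]
    apply ENNReal.ofReal_le_ofReal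
    calc ‖u y‖ ^ p = (‖u y‖ ^ 2) ^ (p / 2) := by
          rw [← Real.rpow_natCast, ← Real.rpow_mul (norm_nonneg _)]; congr 1; push_cast; ring
      _ ≤ (1444 * ℓ ^ (-(ρ + τ)) * (K * μ ^ ρ) * (L * ν ^ τ)) ^ (p / 2) := by
          gcongr; exact h y hy
      _ = (1444 * ℓ ^ (-(ρ + τ)) * (K * L) * (μ ^ ρ * ν ^ τ)) ^ (p / 2) := by congr 1; ring
      _ = M := by
          rw [Real.mul_rpow (by positivity) (by positivity),
            Real.mul_rpow (by positivity) (by positivity),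
            Real.mul_rpow (by positivity) (by positivity),
            Real.mul_rpow (x := μ ^ ρ) (by positivity) (by positivity),
            ← Real.rpow_mul hℓ.le, ← Real.rpow_mul hIH, ← Real.rpow_mul hIW, hM,
            ← Real.rpow_neg_one ℓ, show -(ρ + τ) * (p / 2) = -1 by linarith,
            show ρ * (p / 2) = p * ρ / 2 by ring, show τ * (p / 2) = p * τ / 2 by ring]
  calc ∫⁻ t in Icc a b, ‖u t‖ₑ ^ p ≤ ∫⁻ _ in Icc a b, ENNReal.ofReal M :=
        setLIntegral_mono measurable_const hpt
    _ = ENNReal.ofReal M * ENNReal.ofReal (b - a) := by simp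
    _ ≤ ENNReal.ofReal M * ENNReal.ofReal (2 * ℓ) := by gcongr
    _ = ENNReal.ofReal (2 * 1444 ^ (p / 2) * (K * L) ^ (p / 2) *
          (μ ^ (p * ρ / 2) * ν ^ (p * τ / 2))) := by
        rw [← ENNReal.ofReal_mul hM0, hM]; congr 1; field_simp
    _ = _ := by
        rw [ENNReal.ofReal_mul (by positivity), ENNReal.ofReal_mul (by positivity),
          ENNReal.ofReal_mul (p := μ ^ _) (by positivity),
          ENNReal.ofReal_rpow_of_nonneg (by positivity) (by positivity),
          ENNReal.ofReal_rpow_of_nonneg hIH (by positivity),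
          ENNReal.ofReal_rpow_of_nonneg hIW (by positivity)]

lemma exists_setLIntegral_norm_deriv_rpow_le {p ρ τ : ℝ} (hp : 0 < p)
    (hpρτ : p * (ρ + τ) = 2) (hρ0 : 0 ≤ ρ) (hρ1 : ρ ≤ 1) (hτ0 : 0 ≤ τ) (hτ1 : τ ≤ 1) :
    ∃ C : ℝ≥0, ∀ {F : Type*} [NormedAddCommGroup F] [NormedSpace ℝ F] [CompleteSpace F]
      {v v' v'' : ℝ → F} (_ : ∀ t, HasDerivAt v (v' t) t) (_ : ∀ t, HasDerivAt v' (v'' t) t)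
      (_ : Continuous v'') {c K L : ℝ} {H W : ℝ → ℝ}
      (_ : Continuous H) (_ : ∀ t, 0 ≤ H t) (_ : Continuous W) (_ : ∀ t, 0 ≤ W t)
      (_ : 0 ≤ K) (_ : 0 ≤ L)
      (_ : ∀ t ∈ Icc c (c + 1), ‖v t‖ ≤ K * H t ^ ρ)
      (_ : ∀ t ∈ Icc c (c + 1), ‖v'' t‖ ≤ L * W t ^ τ)
      (_ : K * (∫ t in c..c + 1, H t) ^ ρ ≤ L * (∫ t in c..c + 1, W t) ^ τ),
      ∫⁻ t in Icc c (c + 1), ‖v' t‖ₑ ^ p ≤ C * ENNReal.ofReal (K * L) ^ (p / 2) *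
        ((∫⁻ t in Icc c (c + 1), ENNReal.ofReal (H t)) ^ (p * ρ / 2) *
        (∫⁻ t in Icc c (c + 1), ENNReal.ofReal (W t)) ^ (p * τ / 2)) := by
  obtain ⟨N, σ, hσ, hN⟩ := HasBesicovitchCovering.no_satelliteConfig (α := ℝ)
  refine ⟨N * (2 * 1444 ^ (p / 2) : ℝ).toNNReal, ?_⟩
  intro F _ _ _ v v' v'' hv hv' hv'' c K L H W hH hH0 hW hW0 hK hL h₁ h₂ h₃
  have hex := fun x : {x : ℝ // x ∈ Icc c (c + 1) ∧ v' x ≠ 0} =>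
    exists_balanced_scale hv hv' hv'' hH hH0 hW hW0 hK hL hρ0 hρ1 hτ0 hτ1 h₁ h₂ h₃ x.2.1 x.2.2
  choose r hr0 hr1 hr using hex
  obtain ⟨s, hdisj, hcov⟩ := Besicovitch.exist_disjoint_covering_families hσ hN
    { c := fun x : {x : ℝ // x ∈ Icc c (c + 1) ∧ v' x ≠ 0} => (x : ℝ)
      r := r, rpos := hr0, r_bound := 1, r_le := hr1 }
  simp only at hdisj hcov
  set I : {x : ℝ // x ∈ Icc c (c + 1) ∧ v' x ≠ 0} → Set ℝ :=
    fun x => Icc (max c (x - r x)) (min (c + 1) (x + r x)) with hI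
  have hIeq : ∀ x, I x = Icc c (c + 1) ∩ Metric.closedBall (x : ℝ) (r x) := fun x => by
    rw [Real.closedBall_eq_Icc, Icc_inter_Icc]
  have hcount : ∀ i, (s i).Countable := fun i =>
    (hdisj i).countable_of_nonempty_interior fun x _ =>
      (Metric.nonempty_ball.2 (hr0 x)).mono Metric.ball_subset_interior_closedBall
  have hIdisj : ∀ i, Pairwise (Function.onFun Disjoint fun x : s i => I x) := by
    intro i x y hxy
    have := hdisj i x.2 y.2 (fun h => hxy (Subtype.ext h))
    simp only [Function.onFun, hIeq]
    exact this.mono inter_subset_right inter_subset_right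
  have hfam : ∀ i, ∫⁻ t in ⋃ x : s i, I x, ‖v' t‖ₑ ^ p ≤
      ENNReal.ofReal (2 * 1444 ^ (p / 2)) * ENNReal.ofReal (K * L) ^ (p / 2) *
        ((∫⁻ t in Icc c (c + 1), ENNReal.ofReal (H t)) ^ (p * ρ / 2) *
        (∫⁻ t in Icc c (c + 1), ENNReal.ofReal (W t)) ^ (p * τ / 2)) := by
    intro i
    have : Countable (s i) := (hcount i).to_subtype
    have hsum : ∀ G : ℝ → ℝ≥0∞, ∑' x : s i, ∫⁻ t in I x, G t ≤ ∫⁻ t in Icc c (c + 1), G t := by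
      intro G
      rw [← lintegral_iUnion (fun x => measurableSet_Icc) (hIdisj i)]
      refine lintegral_mono_set (iUnion_subset fun x => ?_)
      exact (hIeq x).trans_subset inter_subset_left
    calc ∫⁻ t in ⋃ x : s i, I x, ‖v' t‖ₑ ^ p ≤ ∑' x : s i, ∫⁻ t in I x, ‖v' t‖ₑ ^ p :=
          lintegral_iUnion_le _ _
      _ ≤ ∑' x : s i, ENNReal.ofReal (2 * 1444 ^ (p / 2)) * ENNReal.ofReal (K * L) ^ (p / 2) *
          ((∫⁻ t in I x, ENNReal.ofReal (H t)) ^ (p * ρ / 2) *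
          (∫⁻ t in I x, ENNReal.ofReal (W t)) ^ (p * τ / 2)) := by
          refine ENNReal.tsum_le_tsum fun x => ?_
          have hx := x.1.2.1
          have := hr0 x
          have := hr1 x
          refine setLIntegral_rpow_le_of_sq_le hH hH0 hW hW0 hp hpρτ hK hL hρ0 hτ0 (hr0 x)
            ?_ ?_ (hr x)
          · exact max_le (le_min (by linarith) (by linarith [hx.1]))
              (le_min (by linarith [hx.2]) (by linarith))
          · linarith [le_max_right c (x - r x), min_le_right (c + 1) (x + r x)]
      _ ≤ _ := by
          rw [ENNReal.tsum_mul_left]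
          gcongr
          refine (tsum_mul_rpow_le _ _ (by positivity) (by positivity) (by linarith)).trans ?_
          gcongr <;> exact hsum _
  have hzero : ∫⁻ t in Icc c (c + 1), ‖v' t‖ₑ ^ p ≤
      ∫⁻ t in ⋃ i, ⋃ x : s i, I x, ‖v' t‖ₑ ^ p := by
    rw [← lintegral_indicator measurableSet_Icc, ← lintegral_indicator]
    · refine lintegral_mono fun t => ?_
      by_cases ht : t ∈ Icc c (c + 1) ∧ v' t ≠ 0
      · have := hcov ⟨⟨t, ht⟩, rfl⟩
        simp only [mem_iUnion] at this
        obtain ⟨i, x, hx, hb⟩ := this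
        have : t ∈ ⋃ i, ⋃ x : s i, I x := by
          simp only [mem_iUnion]
          exact ⟨i, ⟨x, hx⟩, by rw [hIeq]; exact ⟨ht.1, Metric.ball_subset_closedBall hb⟩⟩
        rw [indicator_of_mem this, indicator_of_mem ht.1]
      · have : (Icc c (c + 1)).indicator (fun t => ‖v' t‖ₑ ^ p) t = 0 := by
          rw [indicator_apply_eq_zero]
          intro h
          have : v' t = 0 := by by_contra h'; exact ht ⟨h, h'⟩
          simp [this, hp]
        rw [this]; exact zero_le
    · refine MeasurableSet.iUnion fun i => ?_
      have : Countable (s i) := (hcount i).to_subtype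
      exact MeasurableSet.iUnion fun x => measurableSet_Icc
  calc _ ≤ _ := hzero
    _ ≤ ∑' i, ∫⁻ t in ⋃ x : s i, I x, ‖v' t‖ₑ ^ p := lintegral_iUnion_le _ _
    _ ≤ ∑' i : Fin N, _ := ENNReal.tsum_le_tsum hfam
    _ = _ := by
        rw [tsum_fintype, Finset.sum_const, Finset.card_univ, Fintype.card_fin, nsmul_eq_mul]
        simp only [ENNReal.coe_mul, ENNReal.coe_natCast, ENNReal.ofReal]
        ring

lemma exists_amplitude_le [CompleteSpace F] {v v' : ℝ → F}
    (hv : ∀ t, HasDerivAt v (v' t) t) (hv' : Continuous v') {c K L ρ τ : ℝ} {H W : ℝ → ℝ}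
    (hH : Continuous H) (hH0 : ∀ t, 0 ≤ H t) (hW : Continuous W) (hW0 : ∀ t, 0 ≤ W t)
    (hK : 0 ≤ K) (hL : 0 ≤ L) (hρ0 : 0 ≤ ρ) (hτ0 : 0 ≤ τ) (hτ1 : τ ≤ 1)
    (h₁ : ∀ t ∈ Icc c (c + 1), ‖v t‖ ≤ K * H t ^ ρ)
    (h₁' : ρ ≠ 0 → ∀ t ∈ Icc c (c + 1), K * H t ^ ρ ≤ ‖v t‖)
    (h₂ : ∀ t ∈ Icc c (c + 1), ‖v t‖ ≤ L * W t ^ τ)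
    (h₂' : ∀ t ∈ Icc c (c + 1), ‖v' t‖ ≤ L * W t ^ τ) :
    ∃ K', 0 ≤ K' ∧ K' ≤ K ∧ (∀ t ∈ Icc c (c + 1), ‖v t‖ ≤ K' * H t ^ ρ) ∧
      K' * (∫ t in c..c + 1, H t) ^ ρ ≤ 2 * L * (∫ t in c..c + 1, W t) ^ τ := by
  have hvc : Continuous v := continuous_iff_continuousAt.2 fun t => (hv t).continuousAt
  have hcc : c ≤ c + 1 := by linarith
  have hIW : 0 ≤ ∫ t in c..c + 1, W t := intervalIntegral.integral_nonneg hcc fun t _ => hW0 t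
  have hIH : 0 ≤ ∫ t in c..c + 1, H t := intervalIntegral.integral_nonneg hcc fun t _ => hH0 t
  set S := 2 * L * (∫ t in c..c + 1, W t) ^ τ with hS
  have hS0 : 0 ≤ S := by positivity
  have hWc : Continuous fun t => L * W t ^ τ :=
    continuous_const.mul (hW.rpow_const fun _ => Or.inr hτ0)
  have h_integral : ∀ {u : ℝ → F}, Continuous u → (∀ t ∈ Icc c (c + 1), ‖u t‖ ≤ L * W t ^ τ) →
      ∫ t in c..c + 1, ‖u t‖ ≤ L * (∫ t in c..c + 1, W t) ^ τ := by
    intro u hu hle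
    calc ∫ t in c..c + 1, ‖u t‖ ≤ ∫ t in c..c + 1, L * W t ^ τ :=
          intervalIntegral.integral_mono_on hcc (hu.norm.intervalIntegrable _ _)
            (hWc.intervalIntegrable _ _) hle
      _ = L * ∫ t in c..c + 1, W t ^ τ := intervalIntegral.integral_const_mul _ _
      _ ≤ L * (∫ t in c..c + 1, W t) ^ τ := by
          gcongr
          simpa using integral_rpow_le hW hW0 hcc hτ0 hτ1
  have hsup : ∀ t ∈ Icc c (c + 1), ‖v t‖ ≤ S := fun t ht => by
    have := norm_le_integral_norm_add_integral_norm_deriv hv hv' ht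
    linarith [h_integral hvc h₂, h_integral hv' h₂']
  rcases eq_or_ne ρ 0 with rfl | hρ
  · refine ⟨min K S, le_min hK hS0, min_le_left _ _, fun t ht => ?_, ?_⟩
    · have := h₁ t ht
      rw [Real.rpow_zero, mul_one] at this ⊢
      exact le_min this (hsup t ht)
    · rw [Real.rpow_zero, mul_one]; exact min_le_right _ _
  · refine ⟨K, hK, le_rfl, h₁, ?_⟩
    have hρp : 0 < ρ := lt_of_le_of_ne hρ0 hρ.symm
    have hpt : ∀ t ∈ Icc c (c + 1), K ^ ρ⁻¹ * H t ≤ S ^ ρ⁻¹ := fun t ht => by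
      have := Real.rpow_le_rpow (mul_nonneg hK (Real.rpow_nonneg (hH0 t) _))
        ((h₁' hρ t ht).trans (hsup t ht)) (inv_nonneg.2 hρ0)
      rwa [Real.mul_rpow hK (Real.rpow_nonneg (hH0 t) _), Real.rpow_rpow_inv (hH0 t) hρ] at this
    have hi : K ^ ρ⁻¹ * (∫ t in c..c + 1, H t) ≤ S ^ ρ⁻¹ := by
      rw [← intervalIntegral.integral_const_mul]
      refine (intervalIntegral.integral_mono_on hcc
        ((continuous_const.mul hH).intervalIntegrable _ _) (by simp) hpt).trans ?_
      simp
    have := Real.rpow_le_rpow (mul_nonneg (Real.rpow_nonneg hK _) hIH) hi hρ0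
    rwa [Real.mul_rpow (Real.rpow_nonneg hK _) hIH, Real.rpow_inv_rpow hK hρ,
      Real.rpow_inv_rpow hS0 hρ] at this

end OneDim

section Directional

variable {X F : Type*} [NormedAddCommGroup X] [NormedSpace ℝ X]
  [NormedAddCommGroup F] [NormedSpace ℝ F]

lemma hasDerivAt_comp_line {u : X → F} (hu : Differentiable ℝ u) (x e : X) (t : ℝ) :
    HasDerivAt (fun t : ℝ => u (x + t • e)) (fderiv ℝ u (x + t • e) e) t := by
  have h : HasDerivAt (fun t : ℝ => x + t • e) e t := by
    simpa using ((hasDerivAt_id t).smul_const e).const_add x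
  exact (hu _).hasFDerivAt.comp_hasDerivAt t h

lemma hasDerivAt_fderiv_comp_line {u : X → F} (hu : Differentiable ℝ (fderiv ℝ u)) (x e : X)
    (t : ℝ) :
    HasDerivAt (fun t : ℝ => fderiv ℝ u (x + t • e) e)
      (fderiv ℝ (fderiv ℝ u) (x + t • e) e e) t :=
  (hasDerivAt_comp_line hu x e t).clm_apply (hasDerivAt_const t e) |>.congr_deriv (by simp)

lemma lintegral_lintegral_line [MeasurableSpace X] [BorelSpace X] [SecondCountableTopology X]
    (μ : Measure X) [SFinite μ] [μ.IsAddRightInvariant] {Φ : X → ℝ≥0∞} (hΦ : Measurable Φ)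
    (S : Set ℝ) (e : X) :
    ∫⁻ x, (∫⁻ t in S, Φ (x + t • e)) ∂μ = volume S * ∫⁻ x, Φ x ∂μ := by
  rw [lintegral_lintegral_swap]
  · simp [lintegral_add_right_eq_self, mul_comm]
  · have : Measurable fun z : X × ℝ => z.1 + z.2 • e := by fun_prop
    exact (hΦ.comp this).aemeasurable

lemma norm_clm_apply_le_of_le_one (A : X →L[ℝ] F) {e : X} (he : ‖e‖ ≤ 1) : ‖A e‖ ≤ ‖A‖ :=
  A.le_of_opNorm_le_of_le le_rfl he |>.trans (by simp)

lemma sq_norm_fderiv_apply_le [CompleteSpace F] {u : X → F} (hu : ContDiff ℝ 2 u)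
    {Ω : Set X} {e x : X} {K L : ℝ} (he : ‖e‖ ≤ 1) (hx : ∀ t ∈ Icc (0 : ℝ) 1, x + t • e ∈ Ω)
    (hK : 0 ≤ K) (hL : 0 ≤ L) (h₀ : ∀ y ∈ Ω, ‖u y‖ ≤ K)
    (h₁ : ∀ y ∈ Ω, ‖u y‖ + ‖fderiv ℝ u y‖ + ‖fderiv ℝ (fderiv ℝ u) y‖ ≤ L) :
    ‖fderiv ℝ u x e‖ ^ 2 ≤ 2888 * (K * L) := by
  have hu' : ContDiff ℝ 1 (fderiv ℝ u) := hu.fderiv_right (by norm_num)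
  have hu'' : Continuous (fderiv ℝ (fderiv ℝ u)) := hu'.continuous_fderiv (by norm_num)
  have hline : Continuous fun t : ℝ => x + t • e := by fun_prop
  have hd := hasDerivAt_comp_line (hu.differentiable (by norm_num)) x e
  have hd' := hasDerivAt_fderiv_comp_line (hu'.differentiable (by norm_num)) x e
  have hc'' : Continuous fun t : ℝ => fderiv ℝ (fderiv ℝ u) (x + t • e) e e :=
    ((hu''.comp hline).clm_apply continuous_const).clm_apply continuous_const
  have hc' : Continuous fun t : ℝ => fderiv ℝ u (x + t • e) e :=
    (hu'.continuous.comp hline).clm_apply continuous_const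
  have hb : ∀ t ∈ Icc (0 : ℝ) (0 + 1), x + t • e ∈ Ω := by simpa using hx
  have b1 : ∀ t : ℝ, ‖fderiv ℝ u (x + t • e) e‖ ≤ ‖fderiv ℝ u (x + t • e)‖ := fun t =>
    norm_clm_apply_le_of_le_one _ he
  have b2 : ∀ t : ℝ, ‖fderiv ℝ (fderiv ℝ u) (x + t • e) e e‖ ≤ ‖fderiv ℝ (fderiv ℝ u) (x + t • e)‖ :=
    fun t => (norm_clm_apply_le_of_le_one _ he).trans (norm_clm_apply_le_of_le_one _ he)
  have hone : Continuous fun _ : ℝ => (1 : ℝ) := continuous_const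
  obtain ⟨K', hK'0, hK'K, hK', htop⟩ := exists_amplitude_le (c := 0) (K := K) (L := L) (ρ := 0)
    (τ := 0) hd hc' hone (fun _ => zero_le_one) hone (fun _ => zero_le_one) hK hL le_rfl le_rfl
    zero_le_one (fun t ht => by simpa using h₀ _ (hb t ht)) (by simp)
    (fun t ht => by
      have := h₁ _ (hb t ht)
      simp only [Real.rpow_zero, mul_one]
      linarith [norm_nonneg (fderiv ℝ u (x + t • e)),
        norm_nonneg (fderiv ℝ (fderiv ℝ u) (x + t • e))])
    (fun t ht => by
      have := h₁ _ (hb t ht)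
      simp only [Real.rpow_zero, mul_one]
      linarith [b1 t, norm_nonneg (u (x + t • e)),
        norm_nonneg (fderiv ℝ (fderiv ℝ u) (x + t • e))])
  by_cases h0 : fderiv ℝ u x e = 0
  · rw [h0]; simp; positivity
  obtain ⟨ℓ, hℓ0, hℓ1, hℓ⟩ := exists_balanced_scale (c := 0) (x := 0) (K := K') (L := 2 * L)
    (ρ := 0) (τ := 0) hd hd' hc'' hone (fun _ => zero_le_one) hone (fun _ => zero_le_one) hK'0
    (by positivity) le_rfl zero_le_one le_rfl zero_le_one hK'
    (fun t ht => by
      have := h₁ _ (hb t ht)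
      simp only [Real.rpow_zero, mul_one]
      linarith [b2 t, norm_nonneg (u (x + t • e)), norm_nonneg (fderiv ℝ u (x + t • e))])
    htop (by simp) (by simpa using h0)
  have := hℓ 0 ⟨by simp [hℓ0.le], by simp [hℓ0.le]⟩
  simp only [zero_smul, add_zero, neg_zero, Real.rpow_zero, mul_one] at this
  refine this.trans ?_
  nlinarith [mul_le_mul_of_nonneg_right hK'K hL]

lemma exists_setLIntegral_fderiv_apply_rpow_le (X F : Type*) [NormedAddCommGroup X]
    [NormedSpace ℝ X] [MeasureSpace X] [BorelSpace X] [SecondCountableTopology X]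
    [SFinite (volume : Measure X)] [(volume : Measure X).IsAddRightInvariant]
    [NormedAddCommGroup F] [NormedSpace ℝ F] [CompleteSpace F]
    {p ρ τ : ℝ} (hp : 0 < p)
    (hpρτ : p * (ρ + τ) = 2) (hρ0 : 0 ≤ ρ) (hρ1 : ρ ≤ 1) (hτ0 : 0 ≤ τ) (hτ1 : τ ≤ 1) :
    ∃ C : ℝ≥0, ∀ {u : X → F} (_ : ContDiff ℝ 2 u) {Ω E : Set X} (_ : MeasurableSet Ω)
      (_ : MeasurableSet E) {e : X} (_ : ‖e‖ ≤ 1)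
      (_ : ∀ x ∈ E, ∀ t ∈ Icc (0 : ℝ) 1, x + t • e ∈ Ω) {K L : ℝ} (_ : 0 ≤ K) (_ : 0 ≤ L)
      {H W : X → ℝ} (_ : Continuous H) (_ : ∀ x, 0 ≤ H x) (_ : Continuous W) (_ : ∀ x, 0 ≤ W x)
      (_ : ∀ x ∈ closure Ω, ‖u x‖ ≤ K * H x ^ ρ)
      (_ : ρ ≠ 0 → ∀ x ∈ closure Ω, K * H x ^ ρ ≤ ‖u x‖)
      (_ : ∀ x ∈ closure Ω,
        ‖u x‖ + ‖fderiv ℝ u x‖ + ‖fderiv ℝ (fderiv ℝ u) x‖ ≤ L * W x ^ τ),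
      ∫⁻ x in E, ‖fderiv ℝ u x e‖ₑ ^ p ≤ C * ENNReal.ofReal (K * L) ^ (p / 2) *
        ((∫⁻ x in Ω, ENNReal.ofReal (H x)) ^ (p * ρ / 2) *
        (∫⁻ x in Ω, ENNReal.ofReal (W x)) ^ (p * τ / 2)) := by
  obtain ⟨C₀, hC₀⟩ := exists_setLIntegral_norm_deriv_rpow_le hp hpρτ hρ0 hρ1 hτ0 hτ1
  set C₁ : ℝ≥0∞ := C₀ * 2 ^ (p / 2) with hC₁
  have hC₁t : C₁ ≠ ∞ := by
    rw [hC₁]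
    exact ENNReal.mul_ne_top ENNReal.coe_ne_top (ENNReal.rpow_ne_top_of_nonneg (by positivity) (by simp))
  refine ⟨(4 * C₁).toNNReal, ?_⟩
  intro u hu Ω E hΩ hE e he hEΩ K L hK hL H W hH hH0 hW hW0 h₁ h₁' h₂
  rw [ENNReal.coe_toNNReal (ENNReal.mul_ne_top (by simp) hC₁t)]
  have hu' : ContDiff ℝ 1 (fderiv ℝ u) := hu.fderiv_right (by norm_num)
  have hu'' : Continuous (fderiv ℝ (fderiv ℝ u)) := hu'.continuous_fderiv (by norm_num)
  set G : X → ℝ≥0∞ := fun x => ‖fderiv ℝ u x e‖ₑ ^ p with hG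
  have hGm : Measurable G := by
    have : Continuous fun x => fderiv ℝ u x e := hu'.continuous.clm_apply continuous_const
    exact (this.enorm.measurable).pow_const p
  set P : X → ℝ≥0∞ := Ω.indicator fun x => ENNReal.ofReal (H x) with hP
  set Q : X → ℝ≥0∞ := Ω.indicator fun x => ENNReal.ofReal (W x) with hQ
  have hPm : Measurable P := hH.measurable.ennreal_ofReal.indicator hΩ
  have hQm : Measurable Q := hW.measurable.ennreal_ofReal.indicator hΩ
  have hpt : ∀ x, ∫⁻ t in Icc (0 : ℝ) (1 / 2), E.indicator G (x + t • e) ≤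
      C₁ * ENNReal.ofReal (K * L) ^ (p / 2) *
        ((∫⁻ t in Icc (0 : ℝ) 2, P (x + t • e)) ^ (p * ρ / 2) *
          (∫⁻ t in Icc (0 : ℝ) 2, Q (x + t • e)) ^ (p * τ / 2)) := by
    intro x
    set S : Set ℝ := {t | t ∈ Icc (0 : ℝ) (1 / 2) ∧ x + t • e ∈ E} with hS
    have hline : Continuous fun t : ℝ => x + t • e := by fun_prop
    rcases S.eq_empty_or_nonempty with hempty | hne
    · refine (le_of_eq ?_).trans zero_le
      rw [setLIntegral_congr_fun (g := fun _ => 0) measurableSet_Icc, lintegral_zero]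
      intro t ht
      refine indicator_of_notMem (fun h => ?_) _
      have : t ∈ S := ⟨ht, h⟩
      simp [hempty] at this
    have hbdd : BddBelow S := ⟨0, fun t ht => ht.1.1⟩
    set c := sInf S with hc
    have hc0 : 0 ≤ c := le_csInf hne fun t ht => ht.1.1
    have hc1 : c ≤ 1 / 2 := by
      obtain ⟨t, ht⟩ := hne
      exact (csInf_le hbdd ht).trans ht.1.2
    have hIoo : ∀ t ∈ Ioo c (c + 1), x + t • e ∈ Ω := by
      intro t ht
      obtain ⟨t', ht', hlt⟩ := exists_lt_of_csInf_lt hne ht.1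
      have := hEΩ _ ht'.2 (t - t') ⟨by linarith, by linarith [csInf_le hbdd ht', ht.2]⟩
      rwa [add_assoc, ← add_smul, add_sub_cancel] at this
    have hIcc : ∀ t ∈ Icc c (c + 1), x + t • e ∈ closure Ω := by
      rw [← closure_Ioo (by linarith : c ≠ c + 1)]
      exact fun t ht => map_mem_closure (f := fun t : ℝ => x + t • e) hline ht hIoo
    have hd := hasDerivAt_comp_line (hu.differentiable (by norm_num)) x e
    have hd' := hasDerivAt_fderiv_comp_line (hu'.differentiable (by norm_num)) x e
    have hc'' : Continuous fun t : ℝ => fderiv ℝ (fderiv ℝ u) (x + t • e) e e :=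
      ((hu''.comp hline).clm_apply continuous_const).clm_apply continuous_const
    have hc' : Continuous fun t : ℝ => fderiv ℝ u (x + t • e) e :=
      (hu'.continuous.comp hline).clm_apply continuous_const
    have b1 : ∀ t : ℝ, ‖fderiv ℝ u (x + t • e) e‖ ≤ ‖fderiv ℝ u (x + t • e)‖ := fun t =>
      norm_clm_apply_le_of_le_one _ he
    have b2 : ∀ t : ℝ,
        ‖fderiv ℝ (fderiv ℝ u) (x + t • e) e e‖ ≤ ‖fderiv ℝ (fderiv ℝ u) (x + t • e)‖ :=
      fun t => (norm_clm_apply_le_of_le_one _ he).trans (norm_clm_apply_le_of_le_one _ he)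
    obtain ⟨K', hK'0, hK'K, hK', htop⟩ := exists_amplitude_le (c := c) (K := K) (L := L) (ρ := ρ)
      (τ := τ) hd hc' (hH.comp hline) (fun t => hH0 _) (hW.comp hline) (fun t => hW0 _) hK hL hρ0
      hτ0 hτ1 (fun t ht => h₁ _ (hIcc t ht)) (fun h t ht => h₁' h _ (hIcc t ht))
      (fun t ht => by
        have := h₂ _ (hIcc t ht)
        simp only [Function.comp]
        linarith [norm_nonneg (fderiv ℝ u (x + t • e)),
          norm_nonneg (fderiv ℝ (fderiv ℝ u) (x + t • e))])
      (fun t ht => by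
        have := h₂ _ (hIcc t ht)
        simp only [Function.comp]
        linarith [b1 t, norm_nonneg (u (x + t • e)),
          norm_nonneg (fderiv ℝ (fderiv ℝ u) (x + t • e))])
    have hmain := hC₀ (c := c) hd hd' hc'' (hH.comp hline) (fun t => hH0 _) (hW.comp hline)
      (fun t => hW0 _) hK'0 (by positivity : 0 ≤ 2 * L) hK'
      (fun t ht => by
        have := h₂ _ (hIcc t ht)
        have : 0 ≤ L * W (x + t • e) ^ τ := mul_nonneg hL (Real.rpow_nonneg (hW0 _) _)
        simp only [Function.comp]
        linarith [b2 t, norm_nonneg (u (x + t • e)), norm_nonneg (fderiv ℝ u (x + t • e))])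
      htop
    have hsub : ∀ {J : X → ℝ}, ∫⁻ t in Icc c (c + 1), ENNReal.ofReal (J (x + t • e)) ≤
        ∫⁻ t in Icc (0 : ℝ) 2, Ω.indicator (fun x => ENNReal.ofReal (J x)) (x + t • e) := by
      intro J
      rw [Measure.restrict_congr_set Ioo_ae_eq_Icc.symm]
      calc ∫⁻ t in Ioo c (c + 1), ENNReal.ofReal (J (x + t • e))
          = ∫⁻ t in Ioo c (c + 1), Ω.indicator (fun x => ENNReal.ofReal (J x)) (x + t • e) :=
            setLIntegral_congr_fun measurableSet_Ioo fun t ht => by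
              rw [indicator_of_mem (hIoo t ht)]
        _ ≤ _ := lintegral_mono_set fun t ht =>
            (⟨by linarith [ht.1], by linarith [ht.2]⟩ : t ∈ Icc (0 : ℝ) 2)
    calc ∫⁻ t in Icc (0 : ℝ) (1 / 2), E.indicator G (x + t • e)
        ≤ ∫⁻ t in Icc c (c + 1), G (x + t • e) := by
          rw [← lintegral_indicator measurableSet_Icc, ← lintegral_indicator measurableSet_Icc]
          refine lintegral_mono fun t => ?_
          by_cases ht : t ∈ S
          · rw [indicator_of_mem ht.1, indicator_of_mem ht.2, indicator_of_mem]
            exact ⟨csInf_le hbdd ht, by linarith [ht.1.2]⟩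
          · refine (le_of_eq ?_).trans zero_le
            rw [indicator_apply_eq_zero]
            exact fun h => indicator_of_notMem (fun h' => ht ⟨h, h'⟩) _
      _ ≤ _ := hmain
      _ ≤ C₀ * (2 ^ (p / 2) * ENNReal.ofReal (K * L) ^ (p / 2)) *
          ((∫⁻ t in Icc (0 : ℝ) 2, P (x + t • e)) ^ (p * ρ / 2) *
          (∫⁻ t in Icc (0 : ℝ) 2, Q (x + t • e)) ^ (p * τ / 2)) := by
          rw [mul_assoc, mul_assoc]
          refine mul_le_mul_right (mul_le_mul' ?_ (mul_le_mul' ?_ ?_)) _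
          · rw [← ENNReal.mul_rpow_of_nonneg _ _ (by positivity)]
            gcongr
            rw [← ENNReal.ofReal_ofNat 2, ← ENNReal.ofReal_mul (by norm_num)]
            apply ENNReal.ofReal_le_ofReal
            nlinarith [mul_le_mul_of_nonneg_right hK'K hL]
          · exact ENNReal.rpow_le_rpow hsub (by positivity)
          · exact ENNReal.rpow_le_rpow hsub (by positivity)
      _ = _ := by rw [hC₁]; ring
  have hsum : p * ρ / 2 + p * τ / 2 = 1 := by linarith
  have hmeas : ∀ {Φ : X → ℝ≥0∞}, Measurable Φ →
      Measurable fun x => ∫⁻ t in Icc (0 : ℝ) 2, Φ (x + t • e) := by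
    intro Φ hΦ
    have : Measurable fun z : X × ℝ => z.1 + z.2 • e := by fun_prop
    exact (hΦ.comp this).lintegral_prod_right'
  have hhalf : (volume (Icc (0 : ℝ) (1 / 2)))  = 2⁻¹ := by
    rw [Real.volume_Icc, sub_zero, one_div, ENNReal.ofReal_inv_of_pos (by norm_num)]; simp
  have htwo : (volume (Icc (0 : ℝ) 2))  = 2 := by simp
  have h_integral : 2⁻¹ * ∫⁻ x in E, G x ≤ C₁ * ENNReal.ofReal (K * L) ^ (p / 2) *
      (2 * ((∫⁻ x in Ω, ENNReal.ofReal (H x)) ^ (p * ρ / 2) *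
        (∫⁻ x in Ω, ENNReal.ofReal (W x)) ^ (p * τ / 2))) := by
    calc 2⁻¹ * ∫⁻ x in E, G x
        = ∫⁻ x, ∫⁻ t in Icc (0 : ℝ) (1 / 2), E.indicator G (x + t • e) := by
          rw [lintegral_lintegral_line _ (hGm.indicator hE), hhalf, lintegral_indicator hE]
      _ ≤ ∫⁻ x, C₁ * ENNReal.ofReal (K * L) ^ (p / 2) *
          ((∫⁻ t in Icc (0 : ℝ) 2, P (x + t • e)) ^ (p * ρ / 2) *
          (∫⁻ t in Icc (0 : ℝ) 2, Q (x + t • e)) ^ (p * τ / 2)) := lintegral_mono hpt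
      _ = C₁ * ENNReal.ofReal (K * L) ^ (p / 2) *
          ∫⁻ x, ((∫⁻ t in Icc (0 : ℝ) 2, P (x + t • e)) ^ (p * ρ / 2) *
          (∫⁻ t in Icc (0 : ℝ) 2, Q (x + t • e)) ^ (p * τ / 2)) :=
          lintegral_const_mul _ (((hmeas hPm).pow_const _).mul ((hmeas hQm).pow_const _))
      _ ≤ C₁ * ENNReal.ofReal (K * L) ^ (p / 2) *
          ((∫⁻ x, ∫⁻ t in Icc (0 : ℝ) 2, P (x + t • e)) ^ (p * ρ / 2) *
          (∫⁻ x, ∫⁻ t in Icc (0 : ℝ) 2, Q (x + t • e)) ^ (p * τ / 2)) := by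
          gcongr
          exact ENNReal.lintegral_mul_norm_pow_le (hmeas hPm).aemeasurable
            (hmeas hQm).aemeasurable (by positivity) (by positivity) hsum
      _ = _ := by
          rw [lintegral_lintegral_line _ hPm, lintegral_lintegral_line _ hQm, htwo,
            ENNReal.mul_rpow_of_nonneg _ _ (by positivity),
            ENNReal.mul_rpow_of_nonneg _ _ (by positivity), hP, hQ,
            lintegral_indicator hΩ, lintegral_indicator hΩ]
          congr 1
          rw [mul_mul_mul_comm, ← ENNReal.rpow_add _ _ (by simp) (by simp), hsum, ENNReal.rpow_one]
  calc ∫⁻ x in E, G x = 2 * (2⁻¹ * ∫⁻ x in E, G x) := by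
        rw [← mul_assoc, ENNReal.mul_inv_cancel (by simp) (by simp), one_mul]
    _ ≤ 2 * (C₁ * ENNReal.ofReal (K * L) ^ (p / 2) *
        (2 * ((∫⁻ x in Ω, ENNReal.ofReal (H x)) ^ (p * ρ / 2) *
          (∫⁻ x in Ω, ENNReal.ofReal (W x)) ^ (p * τ / 2)))) := by gcongr
    _ = _ := by ring

end Directional

section Amplitude

variable {X : Type*} [TopologicalSpace X] [MeasurableSpace X] [OpensMeasurableSpace X]

lemma le_toReal_eLpNorm_top {μ : Measure X} [μ.IsOpenPosMeasure] {v : X → ℝ} (hv : Continuous v)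
    (hv0 : ∀ x, 0 ≤ v x) {Ω : Set X} (hΩ : IsOpen Ω)
    (hfin : eLpNorm v ∞ (μ.restrict Ω) ≠ ∞) {x : X} (hx : x ∈ closure Ω) :
    v x ≤ (eLpNorm v ∞ (μ.restrict Ω)).toReal := by
  set K := (eLpNorm v ∞ (μ.restrict Ω)).toReal with hK
  have hae : ∀ᵐ x ∂μ.restrict Ω, v x ≤ K := by
    filter_upwards [ae_le_eLpNormEssSup (f := v) (μ := μ.restrict Ω)] with y hy
    rw [← eLpNorm_exponent_top] at hy
    have := ENNReal.toReal_mono hfin hy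
    rwa [toReal_enorm, Real.norm_of_nonneg (hv0 y)] at this
  by_contra! hlt
  have hopen : IsOpen {y | K < v y} := isOpen_lt continuous_const hv
  obtain ⟨y, hy⟩ := mem_closure_iff.1 hx _ hopen hlt
  have hpos := (hopen.inter hΩ).measure_pos μ ⟨y, hy⟩
  rw [ae_restrict_iff' hΩ.measurableSet] at hae
  refine hpos.ne' (measure_mono_null (fun z hz => ?_) hae)
  simp only [mem_compl_iff, mem_ofPred_eq, not_forall, not_le]
  exact ⟨hz.2, hz.1⟩

lemma exists_amplitude_density {μ : Measure X} [μ.IsOpenPosMeasure] {v : X → ℝ}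
    (hv : Continuous v) (hv0 : ∀ x, 0 ≤ v x) {Ω : Set X} (hΩ : IsOpen Ω) {r : ℝ≥0∞} (hr : r ≠ 0)
    (hfin : eLpNorm v r (μ.restrict Ω) ≠ ∞) :
    ∃ (K : ℝ) (H : X → ℝ), 0 ≤ K ∧ Continuous H ∧ (∀ x, 0 ≤ H x) ∧
      (∀ x ∈ closure Ω, v x ≤ K * H x ^ r⁻¹.toReal) ∧
      (r⁻¹.toReal ≠ 0 → ∀ x ∈ closure Ω, K * H x ^ r⁻¹.toReal ≤ v x) ∧
      ENNReal.ofReal K * (∫⁻ x in Ω, ENNReal.ofReal (H x) ∂μ) ^ r⁻¹.toReal =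
        eLpNorm v r (μ.restrict Ω) := by
  rcases eq_or_ne r ∞ with rfl | hrt
  · refine ⟨(eLpNorm v ∞ (μ.restrict Ω)).toReal, fun _ => 1, ENNReal.toReal_nonneg,
      continuous_const, fun _ => zero_le_one, fun x hx => ?_, by simp, ?_⟩
    · simpa using le_toReal_eLpNorm_top hv hv0 hΩ hfin hx
    · simpa using hfin
  · have hr0 : r.toReal ≠ 0 := ENNReal.toReal_ne_zero.2 ⟨hr, hrt⟩
    have hpt : ∀ x, 1 * (v x ^ r.toReal) ^ r⁻¹.toReal = v x := fun x => by
      rw [one_mul, ENNReal.toReal_inv, Real.rpow_rpow_inv (hv0 x) hr0]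
    refine ⟨1, fun x => v x ^ r.toReal, zero_le_one,
      hv.rpow_const fun _ => Or.inr ENNReal.toReal_nonneg, fun x => Real.rpow_nonneg (hv0 x) _,
      fun x _ => (hpt x).ge, fun _ x _ => (hpt x).le, ?_⟩
    rw [eLpNorm_eq_lintegral_rpow_enorm_toReal hr hrt, ENNReal.ofReal_one, one_mul,
      ENNReal.toReal_inv, one_div]
    congr 2 with x
    rw [← ENNReal.ofReal_rpow_of_nonneg (hv0 x) ENNReal.toReal_nonneg,
      Real.enorm_eq_ofReal (hv0 x)]

end Amplitude

lemma eLpNorm_ne_top_of_isCompact_closure {X V : Type*} [TopologicalSpace X] [MeasurableSpace X]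
    [OpensMeasurableSpace X] [NormedAddCommGroup V] {μ : Measure X}
    [IsFiniteMeasureOnCompacts μ] {v : X → V} (hv : Continuous v)
    {Ω : Set X} (hΩ : MeasurableSet Ω) (hc : IsCompact (closure Ω)) (r : ℝ≥0∞) :
    eLpNorm v r (μ.restrict Ω) ≠ ∞ := by
  obtain ⟨C, hC⟩ := hc.exists_bound_of_continuousOn hv.continuousOn
  have : IsFiniteMeasure (μ.restrict Ω) :=
    ⟨by simpa using (measure_mono subset_closure).trans_lt hc.measure_lt_top⟩
  refine ((eLpNorm_le_of_ae_bound (C := C) ?_).trans_lt ?_).ne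
  · filter_upwards [ae_restrict_mem hΩ] with x hx using hC x (subset_closure hx)
  · refine ENNReal.mul_lt_top (ENNReal.rpow_lt_top_of_nonneg (by positivity) ?_)
      ENNReal.ofReal_lt_top
    exact measure_ne_top _ _

lemma exists_eLpNorm_fderiv_apply_le (X F : Type*) [NormedAddCommGroup X]
    [NormedSpace ℝ X] [MeasureSpace X] [BorelSpace X] [SecondCountableTopology X]
    [SFinite (volume : Measure X)] [(volume : Measure X).IsAddRightInvariant]
    [(volume : Measure X).IsOpenPosMeasure] [IsFiniteMeasureOnCompacts (volume : Measure X)]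
    [NormedAddCommGroup F] [NormedSpace ℝ F] [CompleteSpace F]
    {p r s : ℝ≥0∞} (hr : 1 ≤ r) (hs : 1 ≤ s) (hprs : 2 * p⁻¹ = r⁻¹ + s⁻¹) :
    ∃ C : ℝ≥0, ∀ {u : X → F} (_ : ContDiff ℝ 2 u) {Ω E : Set X} (_ : IsOpen Ω)
      (_ : IsCompact (closure Ω)) (_ : MeasurableSet E) {e : X} (_ : ‖e‖ ≤ 1)
      (_ : ∀ x ∈ E, ∀ t ∈ Icc (0 : ℝ) 1, x + t • e ∈ Ω),
      eLpNorm (fun x => fderiv ℝ u x e) p (volume.restrict E) ≤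
        C * (eLpNorm u r (volume.restrict Ω) ^ (1 / 2 : ℝ) *
          eLpNorm (fun x => ‖u x‖ + ‖fderiv ℝ u x‖ + ‖fderiv ℝ (fderiv ℝ u) x‖) s
            (volume.restrict Ω) ^ (1 / 2 : ℝ)) := by
  have hr0 : r ≠ 0 := (one_pos.trans_le hr).ne'
  have hs0 : s ≠ 0 := (one_pos.trans_le hs).ne'
  have hri : r⁻¹ ≤ 1 := ENNReal.inv_le_one.2 hr
  have hsi : s⁻¹ ≤ 1 := ENNReal.inv_le_one.2 hs
  have hrit : r⁻¹ ≠ ∞ := ENNReal.inv_ne_top.2 hr0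
  have hsit : s⁻¹ ≠ ∞ := ENNReal.inv_ne_top.2 hs0
  have hp0 : p ≠ 0 := by
    rintro rfl
    simp at hprs
    exact (ENNReal.add_ne_top.2 ⟨hrit, hsit⟩) (by simpa using hprs.symm)
  set ρ := r⁻¹.toReal with hρ
  set τ := s⁻¹.toReal with hτ
  have hρ1 : ρ ≤ 1 := ENNReal.toReal_mono ENNReal.one_ne_top hri |>.trans_eq (by simp)
  have hτ1 : τ ≤ 1 := ENNReal.toReal_mono ENNReal.one_ne_top hsi |>.trans_eq (by simp)
  have hρ0 : 0 ≤ ρ := ENNReal.toReal_nonneg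
  have hτ0 : 0 ≤ τ := ENNReal.toReal_nonneg
  have hsum : 2 * p.toReal⁻¹ = ρ + τ := by
    rw [hρ, hτ, ← ENNReal.toReal_add hrit hsit, ← hprs]; simp
  suffices h : ∃ C : ℝ≥0, ∀ {u : X → F} (_ : ContDiff ℝ 2 u) {Ω E : Set X} (_ : IsOpen Ω)
      (_ : MeasurableSet E) {e : X} (_ : ‖e‖ ≤ 1)
      (_ : ∀ x ∈ E, ∀ t ∈ Icc (0 : ℝ) 1, x + t • e ∈ Ω) {K L : ℝ} (_ : 0 ≤ K) (_ : 0 ≤ L)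
      {H W : X → ℝ} (_ : Continuous H) (_ : ∀ x, 0 ≤ H x) (_ : Continuous W) (_ : ∀ x, 0 ≤ W x)
      (_ : ∀ x ∈ closure Ω, ‖u x‖ ≤ K * H x ^ ρ)
      (_ : ρ ≠ 0 → ∀ x ∈ closure Ω, K * H x ^ ρ ≤ ‖u x‖)
      (_ : ∀ x ∈ closure Ω,
        ‖u x‖ + ‖fderiv ℝ u x‖ + ‖fderiv ℝ (fderiv ℝ u) x‖ ≤ L * W x ^ τ),
      eLpNorm (fun x => fderiv ℝ u x e) p (volume.restrict E) ≤
        C * ((ENNReal.ofReal K * (∫⁻ x in Ω, ENNReal.ofReal (H x)) ^ ρ) ^ (1 / 2 : ℝ) *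
          (ENNReal.ofReal L * (∫⁻ x in Ω, ENNReal.ofReal (W x)) ^ τ) ^ (1 / 2 : ℝ)) by
    obtain ⟨C, hC⟩ := h
    refine ⟨C, fun {u} hu {Ω E} hΩ hΩc hE {e} he hEΩ => ?_⟩
    have hu' : ContDiff ℝ 1 (fderiv ℝ u) := hu.fderiv_right (by norm_num)
    have hu'' : Continuous (fderiv ℝ (fderiv ℝ u)) := hu'.continuous_fderiv (by norm_num)
    obtain ⟨K, H, hK, hH, hH0, h₁, h₁', hKH⟩ := exists_amplitude_density
      (μ := volume) hu.continuous.norm (fun x => norm_nonneg _) hΩ hr0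
      (eLpNorm_ne_top_of_isCompact_closure hu.continuous.norm hΩ.measurableSet hΩc r)
    have hn : Continuous fun x => ‖fderiv ℝ (fderiv ℝ u) x‖ :=
      (continuous_norm (E := X →L[ℝ] X →L[ℝ] F)).comp hu''
    have hw : Continuous fun x => ‖u x‖ + ‖fderiv ℝ u x‖ + ‖fderiv ℝ (fderiv ℝ u) x‖ :=
      (hu.continuous.norm.add hu'.continuous.norm).add hn
    obtain ⟨L, W, hL, hW, hW0, h₂, -, hLW⟩ := exists_amplitude_density
      (μ := volume) hw (fun x => by positivity) hΩ hs0
      (eLpNorm_ne_top_of_isCompact_closure hw hΩ.measurableSet hΩc s)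
    have := hC hu hΩ hE he hEΩ hK hL hH hH0 hW hW0 h₁ h₁' h₂
    rwa [hKH, hLW, eLpNorm_norm] at this
  rcases eq_or_ne p ∞ with rfl | hpt
  · have hρe : ρ = 0 := by simp at hsum; linarith
    have hτe : τ = 0 := by simp at hsum; linarith
    refine ⟨Real.toNNReal (2888 ^ (1 / 2 : ℝ)), ?_⟩
    intro u hu Ω E hΩ hE e he hEΩ K L hK hL H W hH hH0 hW hW0 h₁ h₁' h₂
    simp only [hρe, hτe, Real.rpow_zero, mul_one, ENNReal.rpow_zero] at h₁ h₂ ⊢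
    rw [ENNReal.ofReal_rpow_of_nonneg hK (by norm_num),
      ENNReal.ofReal_rpow_of_nonneg hL (by norm_num), ← ENNReal.ofReal_mul (by positivity),
      ← Real.mul_rpow hK hL, ← ENNReal.ofReal, ← ENNReal.ofReal_mul (by positivity),
      ← Real.mul_rpow (by norm_num) (by positivity), eLpNorm_exponent_top]
    refine eLpNormEssSup_le_of_ae_bound ?_
    filter_upwards [ae_restrict_mem hE] with x hx
    have := sq_norm_fderiv_apply_le hu he (hEΩ x hx) hK hL
      (fun y hy => h₁ y (subset_closure hy)) (fun y hy => h₂ y (subset_closure hy))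
    rw [← Real.sqrt_eq_rpow]
    exact Real.le_sqrt_of_sq_le this
  · have hp : 0 < p.toReal := ENNReal.toReal_pos hp0 hpt
    obtain ⟨C, hC⟩ := exists_setLIntegral_fderiv_apply_rpow_le X F hp
      (by rw [← hsum]; field_simp) hρ0 hρ1 hτ0 hτ1
    refine ⟨C ^ (1 / p.toReal), ?_⟩
    intro u hu Ω E hΩ hE e he hEΩ K L hK hL H W hH hH0 hW hW0 h₁ h₁' h₂
    rw [eLpNorm_eq_lintegral_rpow_enorm_toReal hp0 hpt]
    have hpi : 0 ≤ 1 / p.toReal := by positivity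
    refine (ENNReal.rpow_le_rpow
      (hC hu hΩ.measurableSet hE he hEΩ hK hL hH hH0 hW hW0 h₁ h₁' h₂) hpi).trans_eq ?_
    have e1 : p.toReal / 2 * (1 / p.toReal) = 1 / 2 := by field_simp
    have e2 : p.toReal * ρ / 2 * (1 / p.toReal) = ρ * (1 / 2) := by field_simp
    have e3 : p.toReal * τ / 2 * (1 / p.toReal) = τ * (1 / 2) := by field_simp
    rw [ENNReal.mul_rpow_of_nonneg _ _ hpi, ENNReal.mul_rpow_of_nonneg _ _ hpi,
      ENNReal.mul_rpow_of_nonneg _ _ hpi, ← ENNReal.rpow_mul, ← ENNReal.rpow_mul,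
      ← ENNReal.rpow_mul, e1, e2, e3, ENNReal.ofReal_mul hK,
      ENNReal.mul_rpow_of_nonneg _ _ (by norm_num), ENNReal.mul_rpow_of_nonneg _ _ (by norm_num),
      ENNReal.mul_rpow_of_nonneg _ _ (by norm_num), ← ENNReal.rpow_mul, ← ENNReal.rpow_mul,
      ENNReal.coe_rpow_of_nonneg _ hpi]
    ring

lemma eLpNorm_restrict_union_le {X V : Type*} [MeasurableSpace X] [NormedAddCommGroup V]
    {μ : Measure X} {v : X → V} {s t : Set X} (hs : MeasurableSet s) (ht : MeasurableSet t)
    (hv : AEStronglyMeasurable v μ) {p : ℝ≥0∞} (hp : 1 ≤ p) :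
    eLpNorm v p (μ.restrict (s ∪ t)) ≤
      eLpNorm v p (μ.restrict s) + eLpNorm v p (μ.restrict t) := by
  rw [← eLpNorm_indicator_eq_eLpNorm_restrict (hs.union ht),
    ← eLpNorm_indicator_eq_eLpNorm_restrict hs, ← eLpNorm_indicator_eq_eLpNorm_restrict ht,
    ← eLpNorm_norm (s.indicator v), ← eLpNorm_norm (t.indicator v)]
  refine le_trans ?_ (eLpNorm_add_le (hv.indicator hs).norm (hv.indicator ht).norm hp)
  refine eLpNorm_mono_real fun x => ?_
  simp only [Pi.add_apply]
  by_cases h1 : x ∈ s <;> by_cases h2 : x ∈ t <;> simp [h1, h2]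

section Cone

variable {X : Type*} [NormedAddCommGroup X] [NormedSpace ℝ X]

lemma exists_cone_of_mem {Ω : Set X} (hΩ : IsOpen Ω) {x₀ : X} (hx₀ : x₀ ∈ Ω) :
    ∃ δ > 0, ∃ (w : X) (ε : ℝ), 0 < ε ∧ ‖w‖ + ε ≤ 1 ∧ ∀ e, ‖e - w‖ ≤ ε →
      ∀ x ∈ Metric.ball x₀ δ ∩ Ω, ∀ t ∈ Icc (0 : ℝ) 1, x + t • e ∈ Ω := by
  obtain ⟨δ, hδ, hsub⟩ := Metric.isOpen_iff.1 hΩ x₀ hx₀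
  refine ⟨δ / 2, by positivity, 0, min 1 (δ / 3), by positivity, by simp, ?_⟩
  rintro e he x ⟨hx, -⟩ t ht
  apply hsub
  rw [Metric.mem_ball, dist_eq_norm] at hx ⊢
  rw [sub_zero] at he
  have h1 : ‖t • e‖ ≤ δ / 3 := by
    rw [norm_smul, Real.norm_of_nonneg ht.1]
    nlinarith [he.trans (min_le_right _ _), norm_nonneg e, ht.2, ht.1]
  calc ‖x + t • e - x₀‖ = ‖(x - x₀) + t • e‖ := by congr 1; abel
    _ ≤ ‖x - x₀‖ + ‖t • e‖ := norm_add_le _ _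
    _ < δ := by linarith

lemma exists_cone_of_fderiv_ne_zero {F : X → ℝ} (hF : ContDiff ℝ 1 F) {x₀ : X}
    (hx₀ : fderiv ℝ F x₀ ≠ 0) :
    ∃ δ > 0, ∃ (w : X) (ε : ℝ), 0 < ε ∧ ‖w‖ + ε ≤ 1 ∧ ∀ e, ‖e - w‖ ≤ ε →
      ∀ x ∈ Metric.ball x₀ δ, ∀ t ∈ Icc (0 : ℝ) 1, F (x + t • e) ≤ F x := by
  obtain ⟨w₁, hw₁⟩ : ∃ w, fderiv ℝ F x₀ w < 0 := by
    obtain ⟨v, hv⟩ : ∃ v, fderiv ℝ F x₀ v ≠ 0 := by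
      by_contra! h
      exact hx₀ (ContinuousLinearMap.ext h)
    rcases lt_or_gt_of_ne hv with h | h
    · exact ⟨v, h⟩
    · exact ⟨-v, by simpa using h⟩
  have hF' : Continuous (fderiv ℝ F) := hF.continuous_fderiv (by norm_num)
  have hopen : IsOpen {z : X × X | fderiv ℝ F z.1 z.2 < 0} :=
    isOpen_lt ((hF'.comp continuous_fst).clm_apply continuous_snd) continuous_const
  obtain ⟨δ, hδ, hsub⟩ := Metric.isOpen_iff.1 hopen (x₀, w₁) hw₁
  have hneg : ∀ x e, ‖x - x₀‖ < δ → ‖e - w₁‖ < δ → fderiv ℝ F x e < 0 := fun x e hx he => by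
    have : (x, e) ∈ Metric.ball (x₀, w₁) δ := by
      rw [← ball_prod_same]
      exact ⟨by simpa [dist_eq_norm] using hx, by simpa [dist_eq_norm] using he⟩
    exact hsub this
  set κ := min 1 (δ / 2) / (‖w₁‖ + δ) with hκ
  have hκ0 : 0 < κ := by positivity
  have hκm : κ * (‖w₁‖ + δ) = min 1 (δ / 2) := by rw [hκ]; field_simp
  have hκw : ‖κ • w₁‖ = κ * ‖w₁‖ := by rw [norm_smul, Real.norm_of_nonneg hκ0.le]
  refine ⟨δ / 2, by positivity, κ • w₁, κ * (δ / 2), by positivity, ?_, ?_⟩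
  · rw [hκw]
    nlinarith [min_le_left 1 (δ / 2)]
  intro e he x hx
  rw [Metric.mem_ball, dist_eq_norm] at hx
  have hen : ‖e‖ ≤ δ / 2 := by
    have := norm_le_norm_add_norm_sub' e (κ • w₁)
    nlinarith [min_le_right 1 (δ / 2)]
  have hmem : ∀ t ∈ Icc (0 : ℝ) 1, ‖x + t • e - x₀‖ < δ := fun t ht => by
    have h1 : ‖t • e‖ ≤ δ / 2 := by
      rw [norm_smul, Real.norm_of_nonneg ht.1]
      nlinarith [norm_nonneg e, ht.2, ht.1]
    calc ‖x + t • e - x₀‖ = ‖(x - x₀) + t • e‖ := by congr 1; abel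
      _ ≤ ‖x - x₀‖ + ‖t • e‖ := norm_add_le _ _
      _ < δ := by linarith
  have hee : ∀ y, ‖y - x₀‖ < δ → fderiv ℝ F y e ≤ 0 := fun y hy => by
    have h1 : ‖κ⁻¹ • e - w₁‖ < δ := by
      have : κ⁻¹ • e - w₁ = κ⁻¹ • (e - κ • w₁) := by
        rw [smul_sub, smul_smul, inv_mul_cancel₀ hκ0.ne', one_smul]
      rw [this, norm_smul, norm_inv, Real.norm_of_nonneg hκ0.le, inv_mul_lt_iff₀ hκ0]
      nlinarith
    have := hneg y _ hy h1
    rw [map_smul, smul_eq_mul] at this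
    exact (neg_of_mul_neg_right this (by positivity)).le
  have hd := hasDerivAt_comp_line (hF.differentiable (by norm_num)) x e
  have hanti : AntitoneOn (fun t : ℝ => F (x + t • e)) (Icc 0 1) := by
    refine antitoneOn_of_deriv_nonpos (convex_Icc 0 1)
      (fun t _ => (hd t).continuousAt.continuousWithinAt)
      (fun t _ => (hd t).differentiableAt.differentiableWithinAt) fun t ht => ?_
    rw [(hd t).deriv]
    exact hee _ (hmem t (interior_subset ht))
  intro t ht
  simpa using hanti (by simp) ht ht.1

end Cone

lemma SmoothDomain.exists_cone {n : ℕ} {Ω : Set (Fin n → ℝ)} (hΩ : SmoothDomain Ω)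
    {x₀ : Fin n → ℝ} (hx₀ : x₀ ∈ closure Ω) :
    ∃ δ > 0, ∃ (w : Fin n → ℝ) (ε : ℝ), 0 < ε ∧ ‖w‖ + ε ≤ 1 ∧ ∀ e, ‖e - w‖ ≤ ε →
      ∀ x ∈ Metric.ball x₀ δ ∩ Ω, ∀ t ∈ Icc (0 : ℝ) 1, x + t • e ∈ Ω := by
  obtain ⟨ho, -, F, hF, hFΩ, hF0⟩ := hΩ
  by_cases hx : x₀ ∈ Ω
  · exact exists_cone_of_mem ho hx
  · have hfr : x₀ ∈ frontier Ω := by rw [ho.frontier_eq]; exact ⟨hx₀, hx⟩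
    obtain ⟨δ, hδ, w, ε, hε, hwε, h⟩ :=
      exists_cone_of_fderiv_ne_zero (hF.of_le (by exact_mod_cast le_top)) (hF0 x₀ hfr)
    refine ⟨δ, hδ, w, ε, hε, hwε, fun e he x hx t ht => ?_⟩
    have hxΩ := hx.2
    rw [hFΩ] at hxΩ ⊢
    exact (h e he x hx.1 t ht).trans_lt hxΩ

lemma norm_clm_pi_le_sum {n : ℕ} {F : Type*} [NormedAddCommGroup F] [NormedSpace ℝ F]
    (A : (Fin n → ℝ) →L[ℝ] F) : ‖A‖ ≤ ∑ i, ‖A (Pi.single i 1)‖ := by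
  refine A.opNorm_le_bound (Finset.sum_nonneg fun i _ => norm_nonneg _) fun x => ?_
  conv_lhs => rw [pi_eq_sum_univ' x]
  rw [map_sum, Finset.sum_mul]
  refine (norm_sum_le _ _).trans (Finset.sum_le_sum fun i _ => ?_)
  rw [map_smul, norm_smul, mul_comm]
  gcongr
  exact norm_le_pi_norm x i

lemma norm_clm_pi_le_sum_cone {n : ℕ} {F : Type*} [NormedAddCommGroup F] [NormedSpace ℝ F]
    (A : (Fin n → ℝ) →L[ℝ] F) (w : Fin n → ℝ) {ε : ℝ} (hε : 0 < ε) :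
    ‖A‖ ≤ ∑ i : Fin n, ε⁻¹ * (‖A (w + ε • Pi.single i 1)‖ + ‖A w‖) := by
  refine (norm_clm_pi_le_sum A).trans (Finset.sum_le_sum fun i _ => ?_)
  have : A (Pi.single i 1) = ε⁻¹ • (A (w + ε • Pi.single i 1) - A w) := by
    rw [map_add, add_sub_cancel_left, map_smul, smul_smul, inv_mul_cancel₀ hε.ne', one_smul]
  rw [this, norm_smul, norm_inv, Real.norm_of_nonneg hε.le]
  gcongr
  exact norm_sub_le _ _

lemma exists_eLpNorm_fderiv_local_le (F : Type*) [NormedAddCommGroup F] [NormedSpace ℝ F]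
    [CompleteSpace F] {n : ℕ} {Ω : Set (Fin n → ℝ)} (hΩ : SmoothDomain Ω) {x₀ : Fin n → ℝ}
    (hx₀ : x₀ ∈ closure Ω) {p r s : ℝ≥0∞} (hp : 1 ≤ p) (hr : 1 ≤ r) (hs : 1 ≤ s)
    (hprs : 2 * p⁻¹ = r⁻¹ + s⁻¹) :
    ∃ δ > 0, ∃ C : ℝ≥0, ∀ u : (Fin n → ℝ) → F, ContDiff ℝ 2 u →
      eLpNorm (fderiv ℝ u) p (volume.restrict (Metric.ball x₀ δ ∩ Ω)) ≤
        C * (eLpNorm u r (volume.restrict Ω) ^ (1 / 2 : ℝ) *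
          eLpNorm (fun x => ‖u x‖ + ‖fderiv ℝ u x‖ + ‖fderiv ℝ (fderiv ℝ u) x‖) s
            (volume.restrict Ω) ^ (1 / 2 : ℝ)) := by
  obtain ⟨C, hC⟩ := exists_eLpNorm_fderiv_apply_le (Fin n → ℝ) F hr hs hprs
  obtain ⟨δ, hδ, w, ε, hε, hwε, h⟩ := hΩ.exists_cone hx₀
  refine ⟨δ, hδ, ∑ i : Fin n, ε⁻¹.toNNReal * (C + C), fun u hu => ?_⟩
  have hE : MeasurableSet (Metric.ball x₀ δ ∩ Ω) :=
    measurableSet_ball.inter hΩ.1.measurableSet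
  have hc : IsCompact (closure Ω) := hΩ.2.1.isCompact_closure
  have hu' : Continuous (fderiv ℝ u) := hu.continuous_fderiv (by norm_num)
  set μ := volume.restrict (Metric.ball x₀ δ ∩ Ω) with hμ
  set R := eLpNorm u r (volume.restrict Ω) ^ (1 / 2 : ℝ) *
    eLpNorm (fun x => ‖u x‖ + ‖fderiv ℝ u x‖ + ‖fderiv ℝ (fderiv ℝ u) x‖) s
      (volume.restrict Ω) ^ (1 / 2 : ℝ)
  have hdir : ∀ e, ‖e - w‖ ≤ ε → eLpNorm (fun x => ‖fderiv ℝ u x e‖) p μ ≤ C * R := by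
    intro e he
    rw [eLpNorm_norm]
    refine hC hu hΩ.1 hc hE ?_ (h e he)
    linarith [norm_le_norm_add_norm_sub' e w]
  have hcont : ∀ e, Continuous fun x => ‖fderiv ℝ u x e‖ := fun e =>
    (hu'.clm_apply continuous_const).norm
  have hsum : ∀ i : Fin n, eLpNorm (fun x => ε⁻¹ * (‖fderiv ℝ u x (w + ε • Pi.single i 1)‖ +
      ‖fderiv ℝ u x w‖)) p μ ≤ (ε⁻¹.toNNReal * (C + C) : ℝ≥0) * R := by
    intro i
    have h1 : ‖w + ε • Pi.single i (1 : ℝ) - w‖ ≤ ε := by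
      rw [add_sub_cancel_left, norm_smul, Real.norm_of_nonneg hε.le, Pi.norm_single]
      simp
    calc eLpNorm (fun x => ε⁻¹ * (‖fderiv ℝ u x (w + ε • Pi.single i 1)‖ +
          ‖fderiv ℝ u x w‖)) p μ
        ≤ ENNReal.ofReal ε⁻¹ * eLpNorm (fun x => ‖fderiv ℝ u x (w + ε • Pi.single i 1)‖ +
          ‖fderiv ℝ u x w‖) p μ := by
          refine (eLpNorm_const_smul_le (c := ε⁻¹)).trans_eq ?_
          rw [Real.enorm_eq_ofReal (by positivity)]
      _ ≤ ENNReal.ofReal ε⁻¹ * (C * R + C * R) := by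
          gcongr
          exact (eLpNorm_add_le (hcont _).aestronglyMeasurable (hcont _).aestronglyMeasurable
            hp).trans (add_le_add (hdir _ h1) (hdir _ (by simpa using hε.le)))
      _ = _ := by push_cast; rw [ENNReal.ofReal]; ring
  calc eLpNorm (fderiv ℝ u) p μ
      ≤ eLpNorm (∑ i : Fin n, fun x => ε⁻¹ * (‖fderiv ℝ u x (w + ε • Pi.single i 1)‖ +
          ‖fderiv ℝ u x w‖)) p μ := by
        refine eLpNorm_mono_real fun x => ?_
        rw [Finset.sum_apply]
        exact norm_clm_pi_le_sum_cone _ w hε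
    _ ≤ ∑ i : Fin n, eLpNorm (fun x => ε⁻¹ * (‖fderiv ℝ u x (w + ε • Pi.single i 1)‖ +
          ‖fderiv ℝ u x w‖)) p μ :=
        eLpNorm_sum_le (fun i _ => (continuous_const.mul
          ((hcont _).add (hcont _))).aestronglyMeasurable) hp
    _ ≤ ∑ i : Fin n, (ε⁻¹.toNNReal * (C + C) : ℝ≥0) * R := Finset.sum_le_sum fun i _ => hsum i
    _ = _ := by rw [← Finset.sum_mul]; push_cast; rfl

lemma exists_eLpNorm_fderiv_le (F : Type*) [NormedAddCommGroup F] [NormedSpace ℝ F]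
    [CompleteSpace F] {n : ℕ} {Ω : Set (Fin n → ℝ)} (hΩ : SmoothDomain Ω)
    {p r s : ℝ≥0∞} (hp : 1 ≤ p) (hr : 1 ≤ r) (hs : 1 ≤ s) (hprs : 2 * p⁻¹ = r⁻¹ + s⁻¹) :
    ∃ C : ℝ≥0, ∀ u : (Fin n → ℝ) → F, ContDiff ℝ 2 u →
      eLpNorm (fderiv ℝ u) p (volume.restrict Ω) ≤
        C * (eLpNorm u r (volume.restrict Ω) ^ (1 / 2 : ℝ) *
          eLpNorm (fun x => ‖u x‖ + ‖fderiv ℝ u x‖ + ‖fderiv ℝ (fderiv ℝ u) x‖) s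
            (volume.restrict Ω) ^ (1 / 2 : ℝ)) := by
  suffices h : ∃ E, MeasurableSet E ∧ closure Ω ∩ Ω ⊆ E ∧ ∃ C : ℝ≥0,
      ∀ u : (Fin n → ℝ) → F, ContDiff ℝ 2 u → eLpNorm (fderiv ℝ u) p (volume.restrict E) ≤
        C * (eLpNorm u r (volume.restrict Ω) ^ (1 / 2 : ℝ) *
          eLpNorm (fun x => ‖u x‖ + ‖fderiv ℝ u x‖ + ‖fderiv ℝ (fderiv ℝ u) x‖) s
            (volume.restrict Ω) ^ (1 / 2 : ℝ)) by
    obtain ⟨E, -, hE, C, hC⟩ := h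
    refine ⟨C, fun u hu => (eLpNorm_mono_measure _ (Measure.restrict_mono ?_ le_rfl)).trans
      (hC u hu)⟩
    exact fun x hx => hE ⟨subset_closure hx, hx⟩
  refine hΩ.2.1.isCompact_closure.induction_on (p := fun S => ∃ E, MeasurableSet E ∧ S ∩ Ω ⊆ E ∧
    ∃ C : ℝ≥0, ∀ u : (Fin n → ℝ) → F, ContDiff ℝ 2 u →
      eLpNorm (fderiv ℝ u) p (volume.restrict E) ≤
        C * (eLpNorm u r (volume.restrict Ω) ^ (1 / 2 : ℝ) *
          eLpNorm (fun x => ‖u x‖ + ‖fderiv ℝ u x‖ + ‖fderiv ℝ (fderiv ℝ u) x‖) s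
            (volume.restrict Ω) ^ (1 / 2 : ℝ))) ?_ ?_ ?_ ?_
  · exact ⟨∅, MeasurableSet.empty, by simp, 0, fun u _ => by simp⟩
  · rintro S T hST ⟨E, hE, hTE, C, hC⟩
    exact ⟨E, hE, (inter_subset_inter_left _ hST).trans hTE, C, hC⟩
  · rintro S T ⟨E, hE, hSE, C, hC⟩ ⟨E', hE', hTE, C', hC'⟩
    refine ⟨E ∪ E', hE.union hE', ?_, C + C', fun u hu => ?_⟩
    · rw [union_inter_distrib_right]; exact union_subset_union hSE hTE
    · have hu' : Continuous (fderiv ℝ u) := hu.continuous_fderiv (by norm_num)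
      refine (eLpNorm_restrict_union_le hE hE' hu'.aestronglyMeasurable hp).trans ?_
      rw [ENNReal.coe_add, add_mul]
      exact add_le_add (hC u hu) (hC' u hu)
  · intro x₀ hx₀
    obtain ⟨δ, hδ, C, hC⟩ := exists_eLpNorm_fderiv_local_le F hΩ hx₀ hp hr hs hprs
    exact ⟨Metric.ball x₀ δ, mem_nhdsWithin_of_mem_nhds (Metric.ball_mem_nhds _ hδ), _,
      measurableSet_ball.inter hΩ.1.measurableSet, subset_rfl, C, hC⟩

section LogConvex

/-- A finite sequence that is log-convex up to a multiplicative constant. -/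
def QuasiLogConvex (C : ℝ≥0) (m : ℕ) (A : ℕ → ℝ≥0∞) : Prop :=
  (∀ k ≤ m, A k ≠ ∞) ∧
    ∀ k, k + 2 ≤ m → A (k + 1) ≤ C * (A k ^ (1 / 2 : ℝ) * A (k + 2) ^ (1 / 2 : ℝ))

lemma QuasiLogConvex.exists_le_succ (C : ℝ≥0) (k : ℕ) :
    ∃ C' : ℝ≥0, ∀ {m : ℕ} {A : ℕ → ℝ≥0∞}, QuasiLogConvex C m A → k + 1 ≤ m →
      A k ≤ C' * (A 0 ^ (1 / (k + 1) : ℝ) * A (k + 1) ^ (k / (k + 1) : ℝ)) := by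
  induction k with
  | zero => exact ⟨1, fun _ _ => by simp⟩
  | succ k ih =>
    obtain ⟨D, hD⟩ := ih
    set b : ℝ := (k + 2) / (2 * (k + 1)) with hb
    have hb0 : 0 < b := by positivity
    refine ⟨(C * D ^ (1 / 2 : ℝ)) ^ b⁻¹, fun {m A} hA hkm => ?_⟩
    rcases eq_or_ne (A (k + 1)) 0 with h0 | h0
    · rw [h0]; exact zero_le
    have hk := hD hA (by lia)
    have hfin := hA.1 (k + 1) (by lia)
    set x := A (k + 1)
    have hx : x ≤ C * ((D * (A 0 ^ (1 / (k + 1) : ℝ) * x ^ (k / (k + 1) : ℝ))) ^ (1 / 2 : ℝ) *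
        A (k + 2) ^ (1 / 2 : ℝ)) := (hA.2 k hkm).trans (by gcongr)
    set a : ℝ := k / (k + 1) * (1 / 2) with ha
    have hab : a + b = 1 := by rw [ha, hb]; field_simp; ring
    have hx' : x ^ a * x ^ b ≤ x ^ a * (C * D ^ (1 / 2 : ℝ) *
        (A 0 ^ (1 / (k + 1) * (1 / 2) : ℝ) * A (k + 2) ^ (1 / 2 : ℝ))) := by
      rw [← ENNReal.rpow_add _ _ h0 hfin, hab, ENNReal.rpow_one]
      refine hx.trans_eq ?_
      rw [ENNReal.mul_rpow_of_nonneg _ _ (by norm_num),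
        ENNReal.mul_rpow_of_nonneg _ _ (by norm_num), ← ENNReal.rpow_mul, ← ENNReal.rpow_mul]
      ring
    have hxa0 : x ^ a ≠ 0 := by simp [ENNReal.rpow_eq_zero_iff, h0, hfin]
    have hxat : x ^ a ≠ ∞ := ENNReal.rpow_ne_top_of_nonneg (by positivity) hfin
    rw [ENNReal.mul_le_mul_iff_right hxa0 hxat] at hx'
    have := ENNReal.rpow_le_rpow hx' (inv_nonneg.2 hb0.le)
    have e1 : (1 / (k + 1) * (1 / 2) : ℝ) * b⁻¹ = 1 / (k + 1 + 1) := by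
      rw [hb]; field_simp; ring
    have e2 : (1 / 2 : ℝ) * b⁻¹ = (k + 1) / (k + 1 + 1) := by
      rw [hb]; field_simp; ring
    rw [← ENNReal.rpow_mul, mul_inv_cancel₀ hb0.ne', ENNReal.rpow_one,
      ENNReal.mul_rpow_of_nonneg _ _ (inv_nonneg.2 hb0.le),
      ENNReal.mul_rpow_of_nonneg (A 0 ^ _) _ (inv_nonneg.2 hb0.le), ← ENNReal.rpow_mul (A 0),
      ← ENNReal.rpow_mul (A (k + 2)), e1, e2] at this
    push_cast
    rw [ENNReal.coe_rpow_of_nonneg _ (inv_nonneg.2 hb0.le), ENNReal.coe_mul,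
      ENNReal.coe_rpow_of_nonneg _ (by norm_num)]
    exact this

lemma QuasiLogConvex.exists_le_rpow_mul_rpow (C : ℝ≥0) {k : ℕ} (M : ℕ) (hkM : k ≤ M) :
    ∃ C' : ℝ≥0, ∀ {m : ℕ} {A : ℕ → ℝ≥0∞}, QuasiLogConvex C m A → M ≤ m →
      A k ≤ C' * (A 0 ^ (1 - k / M : ℝ) * A M ^ (k / M : ℝ)) := by
  rcases Nat.eq_zero_or_pos k with rfl | hk
  · exact ⟨1, fun _ _ => by simp⟩
  induction M, hkM using Nat.le_induction with
  | base =>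
    have : (k : ℝ) ≠ 0 := by exact_mod_cast hk.ne'
    exact ⟨1, fun _ _ => by simp [this]⟩
  | succ M hkM ih =>
    obtain ⟨D, hD⟩ := ih
    obtain ⟨E, hE⟩ := QuasiLogConvex.exists_le_succ C M
    have hM : (0 : ℝ) < M := by exact_mod_cast hk.trans_le hkM
    have hkM' : (k : ℝ) ≤ M := by exact_mod_cast hkM
    have hkM0 : (0 : ℝ) ≤ k / M := by positivity
    have hkM1 : (k : ℝ) / M ≤ 1 := by rw [div_le_one hM]; exact hkM'
    refine ⟨D * E ^ (k / M : ℝ), fun {m A} hA hm => ?_⟩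
    have e1 : (1 - k / M : ℝ) + 1 / (M + 1) * (k / M) = 1 - k / (M + 1 : ℕ) := by
      push_cast; field_simp; ring
    have e2 : (M / (M + 1) : ℝ) * (k / M) = k / (M + 1 : ℕ) := by push_cast; field_simp
    calc A k ≤ D * (A 0 ^ (1 - k / M : ℝ) * A M ^ (k / M : ℝ)) := hD hA (by lia)
      _ ≤ D * (A 0 ^ (1 - k / M : ℝ) *
          (E * (A 0 ^ (1 / (M + 1) : ℝ) * A (M + 1) ^ (M / (M + 1) : ℝ))) ^ (k / M : ℝ)) := by
          gcongr
          exact hE hA hm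
      _ = _ := by
          rw [ENNReal.mul_rpow_of_nonneg _ _ hkM0, ENNReal.mul_rpow_of_nonneg _ _ hkM0,
            ← ENNReal.rpow_mul, ← ENNReal.rpow_mul, e2, ← e1,
            ENNReal.rpow_add_of_nonneg _ _ (by linarith) (by positivity), ENNReal.coe_mul,
            ENNReal.coe_rpow_of_nonneg _ hkM0]
          ring

end LogConvex

lemma eLpNorm_le_rpow_half_mul_rpow_half {X V : Type*} [MeasurableSpace X]
    [NormedAddCommGroup V] {μ : Measure X} {v : X → V} (hv : AEStronglyMeasurable v μ)
    {p r s : ℝ≥0∞} (hprs : 2 * p⁻¹ = r⁻¹ + s⁻¹) :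
    eLpNorm v p μ ≤ eLpNorm v r μ ^ (1 / 2 : ℝ) * eLpNorm v s μ ^ (1 / 2 : ℝ) := by
  have hm : AEStronglyMeasurable (fun x => ‖v x‖ ^ (1 / 2 : ℝ)) μ :=
    (Real.continuous_rpow_const (by norm_num)).comp_aestronglyMeasurable hv.norm
  have hT : ENNReal.HolderTriple (2 * r) (2 * s) p := by
    constructor
    rw [ENNReal.mul_inv (by simp) (by simp), ENNReal.mul_inv (by simp) (by simp), ← mul_add,
      ← hprs, ← mul_assoc, ENNReal.inv_mul_cancel (by simp) (by simp), one_mul]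
  have h2 : ∀ a : ℝ≥0∞, 2 * a * ENNReal.ofReal (1 / 2) = a := fun a => by
    rw [one_div, ENNReal.ofReal_inv_of_pos (by norm_num), mul_right_comm]
    simp [ENNReal.mul_inv_cancel]
  have h := eLpNorm_smul_le_mul_eLpNorm (p := 2 * r) (q := 2 * s) (r := p) hm hm
  rw [eLpNorm_norm_rpow _ (by norm_num), eLpNorm_norm_rpow _ (by norm_num), h2, h2] at h
  refine le_trans (eLpNorm_mono fun x => ?_) h
  simp only [Pi.smul_apply', smul_eq_mul, norm_mul]
  rw [← norm_mul, ← Real.rpow_add_of_nonneg (norm_nonneg _) (by norm_num) (by norm_num)]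
  norm_num

set_option maxSynthPendingDepth 3 in
lemma norm_fderiv_fderiv_iteratedFDeriv {X V : Type*} [NormedAddCommGroup X] [NormedSpace ℝ X]
    [NormedAddCommGroup V] [NormedSpace ℝ V] (f : X → V) (k : ℕ) (x : X) :
    ‖fderiv ℝ (fderiv ℝ (iteratedFDeriv ℝ k f)) x‖ = ‖iteratedFDeriv ℝ (k + 2) f x‖ := by
  rw [fderiv_iteratedFDeriv, LinearIsometryEquiv.comp_fderiv',
    ← norm_fderiv_iteratedFDeriv (n := k + 1)]
  exact LinearIsometry.norm_toContinuousLinearMap_comp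
    (continuousMultilinearCurryLeftEquiv ℝ (fun _ : Fin (k + 1) => X) V).toLinearIsometry

/-- The exponent whose inverse interpolates linearly between `r⁻¹` (at `k = 0`) and
`s⁻¹` (at `k = m`). -/
def interpExp (m : ℕ) (r s : ℝ≥0∞) (k : ℕ) : ℝ≥0∞ :=
  (((m - k : ℕ) : ℝ≥0∞) / m * r⁻¹ + (k : ℝ≥0∞) / m * s⁻¹)⁻¹

lemma interpExp_zero {m : ℕ} (hm : m ≠ 0) (r s : ℝ≥0∞) : interpExp m r s 0 = r := by
  simp [interpExp, ENNReal.div_self (Nat.cast_ne_zero.2 hm) (ENNReal.natCast_ne_top m)]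

lemma interpExp_self {m : ℕ} (hm : m ≠ 0) (r s : ℝ≥0∞) : interpExp m r s m = s := by
  simp [interpExp, ENNReal.div_self (Nat.cast_ne_zero.2 hm) (ENNReal.natCast_ne_top m)]

lemma natCast_sub_div_add_natCast_div {m k : ℕ} (hm : m ≠ 0) (hk : k ≤ m) :
    ((m - k : ℕ) : ℝ≥0∞) / m + (k : ℝ≥0∞) / m = 1 := by
  rw [← ENNReal.add_div, ← Nat.cast_add, Nat.sub_add_cancel hk,
    ENNReal.div_self (Nat.cast_ne_zero.2 hm) (ENNReal.natCast_ne_top m)]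

lemma one_le_interpExp {m k : ℕ} (hm : m ≠ 0) (hk : k ≤ m) {r s : ℝ≥0∞} (hr : 1 ≤ r)
    (hs : 1 ≤ s) : 1 ≤ interpExp m r s k := by
  rw [interpExp, ENNReal.one_le_inv, ← natCast_sub_div_add_natCast_div hm hk]
  gcongr
  · exact mul_le_of_le_one_right' (ENNReal.inv_le_one.2 hr)
  · exact mul_le_of_le_one_right' (ENNReal.inv_le_one.2 hs)

lemma two_mul_inv_interpExp_succ {m k : ℕ} (hk : k + 2 ≤ m) (r s : ℝ≥0∞) :
    2 * (interpExp m r s (k + 1))⁻¹ = (interpExp m r s k)⁻¹ + (interpExp m r s (k + 2))⁻¹ := by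
  obtain ⟨j, rfl⟩ := Nat.exists_eq_add_of_le hk
  have e0 : k + 2 + j - k = j + 2 := by lia
  have e1 : k + 2 + j - (k + 1) = j + 1 := by lia
  have e2 : k + 2 + j - (k + 2) = j := by lia
  simp only [interpExp, inv_inv, e0, e1, e2, div_eq_mul_inv]
  push_cast
  ring

lemma interpExp_holder {m k : ℕ} (hm : m ≠ 0) (hk : k ≤ m) {q r₁ r₂ s₁ s₂ : ℝ≥0∞}
    (h₁ : 1 / q = 1 / r₁ + 1 / s₁) (h₂ : 1 / q = 1 / r₂ + 1 / s₂) :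
    (interpExp m r₁ s₂ k)⁻¹ + (interpExp m r₂ s₁ (m - k))⁻¹ = q⁻¹ := by
  simp only [one_div] at h₁ h₂
  rw [interpExp, interpExp, inv_inv, inv_inv, Nat.sub_sub_self hk]
  calc _ = ((m - k : ℕ) : ℝ≥0∞) / m * (r₁⁻¹ + s₁⁻¹) + (k : ℝ≥0∞) / m * (r₂⁻¹ + s₂⁻¹) := by ring
    _ = _ := by rw [← h₁, ← h₂, ← add_mul, natCast_sub_div_add_natCast_div hm hk, one_mul]

section Interpolation

variable {n : ℕ} {Ω : Set (Fin n → ℝ)}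

lemma continuous_norm_iteratedFDeriv {f : (Fin n → ℝ) → ℝ} {m i : ℕ} (hf : ContDiff ℝ m f)
    (hi : i ≤ m) : Continuous fun x => ‖iteratedFDeriv ℝ i f x‖ :=
  (hf.continuous_iteratedFDeriv (by exact_mod_cast hi)).norm

lemma eLpNorm_iteratedFDeriv_le_WNorm (f : (Fin n → ℝ) → ℝ) (p : ℝ≥0∞) {i k : ℕ} (hik : i ≤ k) :
    eLpNorm (iteratedFDeriv ℝ i f) p (volume.restrict Ω) ≤ WNorm k p Ω f := by
  rw [← eLpNorm_norm]
  exact Finset.single_le_sum (f := fun i => eLpNorm (fun x => ‖iteratedFDeriv ℝ i f x‖) p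
    (volume.restrict Ω)) (fun _ _ => zero_le) (Finset.mem_range.2 (by lia))

set_option maxSynthPendingDepth 3 in
lemma SmoothDomain.exists_eLpNorm_iteratedFDeriv_le (hΩ : SmoothDomain Ω) (k : ℕ)
    {p r s : ℝ≥0∞} (hp : 1 ≤ p) (hr : 1 ≤ r) (hs : 1 ≤ s) (hprs : 2 * p⁻¹ = r⁻¹ + s⁻¹) :
    ∃ C : ℝ≥0, ∀ f : (Fin n → ℝ) → ℝ, ContDiff ℝ (k + 2 : ℕ) f →
      eLpNorm (iteratedFDeriv ℝ (k + 1) f) p (volume.restrict Ω) ≤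
        C * (WNorm k r Ω f ^ (1 / 2 : ℝ) * WNorm (k + 2) s Ω f ^ (1 / 2 : ℝ)) := by
  obtain ⟨C, hC⟩ := exists_eLpNorm_fderiv_le ((Fin n → ℝ) [×k]→L[ℝ] ℝ) hΩ hp hr hs hprs
  refine ⟨C, fun f hf => ?_⟩
  have hu : ContDiff ℝ 2 (iteratedFDeriv ℝ k f) :=
    hf.iteratedFDeriv_right (by push_cast; rw [add_comm])
  have h := hC _ hu
  simp only [norm_fderiv_iteratedFDeriv, norm_fderiv_fderiv_iteratedFDeriv] at h
  rw [← eLpNorm_norm (fderiv ℝ _)] at h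
  simp only [norm_fderiv_iteratedFDeriv] at h
  rw [eLpNorm_norm] at h
  refine h.trans ?_
  have hcont : ∀ i ≤ k + 2, AEStronglyMeasurable (fun x => ‖iteratedFDeriv ℝ i f x‖)
      (volume.restrict Ω) := fun i hi =>
    (continuous_norm_iteratedFDeriv hf hi).aestronglyMeasurable
  gcongr
  · exact eLpNorm_iteratedFDeriv_le_WNorm f r le_rfl
  · refine (eLpNorm_add_le ((hcont k (by lia)).add (hcont (k + 1) (by lia)))
      (hcont (k + 2) le_rfl) hs).trans ((add_le_add_left
        (eLpNorm_add_le (hcont k (by lia)) (hcont (k + 1) (by lia)) hs) _).trans ?_)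
    rw [WNorm, Finset.sum_range_succ, Finset.sum_range_succ, Finset.sum_range_succ]
    gcongr
    exact le_add_self

lemma SmoothDomain.exists_quasiLogConvex (hΩ : SmoothDomain Ω) (m : ℕ) {r s : ℝ≥0∞}
    (hr : 1 ≤ r) (hs : 1 ≤ s) :
    ∃ C : ℝ≥0, ∀ f : (Fin n → ℝ) → ℝ, ContDiff ℝ m f →
      QuasiLogConvex C m fun k => WNorm k (interpExp m r s k) Ω f := by
  have hstep : ∀ k, ∃ C : ℝ≥0, k + 2 ≤ m → ∀ f : (Fin n → ℝ) → ℝ, ContDiff ℝ m f →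
      WNorm (k + 1) (interpExp m r s (k + 1)) Ω f ≤
        C * (WNorm k (interpExp m r s k) Ω f ^ (1 / 2 : ℝ) *
          WNorm (k + 2) (interpExp m r s (k + 2)) Ω f ^ (1 / 2 : ℝ)) := by
    intro k
    by_cases hk : k + 2 ≤ m
    swap
    · exact ⟨0, fun h => absurd h hk⟩
    have hm0 : m ≠ 0 := by lia
    have hmid := two_mul_inv_interpExp_succ hk r s
    obtain ⟨C, hC⟩ := hΩ.exists_eLpNorm_iteratedFDeriv_le k
      (one_le_interpExp hm0 (by lia : k + 1 ≤ m) hr hs)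
      (one_le_interpExp hm0 (by lia : k ≤ m) hr hs) (one_le_interpExp hm0 hk hr hs) hmid
    refine ⟨(k + 1 : ℕ) + C, fun _ f hf => ?_⟩
    set R := WNorm k (interpExp m r s k) Ω f ^ (1 / 2 : ℝ) *
          WNorm (k + 2) (interpExp m r s (k + 2)) Ω f ^ (1 / 2 : ℝ) with hR
    rw [WNorm, Finset.sum_range_succ, ENNReal.coe_add, add_mul]
    gcongr
    · calc _ ≤ ∑ i ∈ Finset.range (k + 1), R := by
            refine Finset.sum_le_sum fun i hi => ?_
            have hi' : i ≤ k := Nat.lt_succ_iff.1 (Finset.mem_range.1 hi)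
            refine (eLpNorm_le_rpow_half_mul_rpow_half (continuous_norm_iteratedFDeriv hf
              (by lia : i ≤ m)).aestronglyMeasurable hmid).trans ?_
            rw [hR, eLpNorm_norm, eLpNorm_norm]
            gcongr
            · exact eLpNorm_iteratedFDeriv_le_WNorm f _ hi'
            · exact eLpNorm_iteratedFDeriv_le_WNorm f _ (by lia)
        _ = _ := by simp
    · rw [eLpNorm_norm]
      exact hC f (hf.of_le (by exact_mod_cast hk))
  choose C hC using hstep
  refine ⟨∑ k ∈ Finset.range m, C k, fun f hf => ⟨fun k hk => ?_, fun k hk => ?_⟩⟩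
  · refine ENNReal.sum_ne_top.2 fun i hi => ?_
    have hi' : i ≤ m := (Nat.lt_succ_iff.1 (Finset.mem_range.1 hi)).trans hk
    exact eLpNorm_ne_top_of_isCompact_closure
      (continuous_norm_iteratedFDeriv hf hi') hΩ.1.measurableSet
      hΩ.2.1.isCompact_closure _
  · refine (hC k hk f hf).trans ?_
    gcongr
    exact Finset.single_le_sum (f := C) (fun _ _ => zero_le) (Finset.mem_range.2 (by lia))

lemma WNorm_zero (p : ℝ≥0∞) (f : (Fin n → ℝ) → ℝ) : WNorm 0 p Ω f = LqN p Ω f := by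
  simp only [WNorm, zero_add, Finset.range_one, Finset.sum_singleton, norm_iteratedFDeriv_zero,
    LqN]
  exact eLpNorm_norm f

/-- Gagliardo–Nirenberg interpolation on a bounded smooth domain. -/
lemma SmoothDomain.exists_gagliardo_nirenberg (hΩ : SmoothDomain Ω) {m k : ℕ} (hm : m ≠ 0)
    (hk : k ≤ m) {r s : ℝ≥0∞} (hr : 1 ≤ r) (hs : 1 ≤ s) :
    ∃ C : ℝ≥0, ∀ f : (Fin n → ℝ) → ℝ, ContDiff ℝ m f →
      eLpNorm (iteratedFDeriv ℝ k f) (interpExp m r s k) (volume.restrict Ω) ≤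
        C * (LqN r Ω f ^ (1 - k / m : ℝ) * WNorm m s Ω f ^ (k / m : ℝ)) := by
  obtain ⟨C, hC⟩ := hΩ.exists_quasiLogConvex m hr hs
  obtain ⟨D, hD⟩ := QuasiLogConvex.exists_le_rpow_mul_rpow C m hk
  refine ⟨D, fun f hf => (eLpNorm_iteratedFDeriv_le_WNorm f _ le_rfl).trans ?_⟩
  have := hD (hC f hf) le_rfl
  rwa [interpExp_zero hm, interpExp_self hm, WNorm_zero] at this

end Interpolation

section MultiIndex

variable {n : ℕ}

lemma Dlist_eq_iteratedFDeriv_apply (l : List (Fin n)) {h : (Fin n → ℝ) → ℝ}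
    (hh : ContDiff ℝ l.length h) :
    ∃ v : Fin l.length → Fin n → ℝ, (∀ i, ‖v i‖ ≤ 1) ∧
      ∀ x, Dlist l h x = iteratedFDeriv ℝ l.length h x v := by
  induction l with
  | nil => exact ⟨fun _ => 0, by simp, fun x => by simp [Dlist]⟩
  | cons i l ih =>
    have hlt : (l.length : WithTop ℕ∞) < (i :: l).length := by
      rw [List.length_cons]; exact_mod_cast Nat.lt_succ_self _
    obtain ⟨v, hv, hD⟩ := ih (hh.of_le hlt.le)
    refine ⟨Fin.cons (Pi.single i 1) v, fun j => ?_, fun x => ?_⟩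
    · refine Fin.cases ?_ (fun j => ?_) j
      · simp [Pi.norm_single]
      · simpa using hv j
    · have hd : DifferentiableAt ℝ (iteratedFDeriv ℝ l.length h) x :=
        hh.differentiable_iteratedFDeriv hlt x
      have : Dlist l h = fun y => iteratedFDeriv ℝ l.length h y v := funext hD
      change fderiv ℝ (Dlist l h) x (Pi.single i 1) =
        iteratedFDeriv ℝ (l.length + 1) h x (Fin.cons (Pi.single i 1) v)
      rw [this, iteratedFDeriv_succ_apply_left, Fin.cons_zero, Fin.tail_cons,
        fderiv_continuousMultilinear_apply_const_apply hd]

lemma length_flatMap_replicate (α : Fin n → ℕ) :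
    ((List.finRange n).flatMap fun i => List.replicate (α i) i).length = mOrder α := by
  simp [List.length_flatMap, mOrder, Fin.sum_univ_def]

lemma norm_Dm_le (α : Fin n → ℕ) {h : (Fin n → ℝ) → ℝ} (hh : ContDiff ℝ (mOrder α) h)
    (x : Fin n → ℝ) : ‖Dm α h x‖ ≤ ‖iteratedFDeriv ℝ (mOrder α) h x‖ := by
  rw [← length_flatMap_replicate] at hh ⊢
  obtain ⟨v, hv, hD⟩ := Dlist_eq_iteratedFDeriv_apply _ hh
  rw [Dm, hD]
  refine ((iteratedFDeriv ℝ _ h x).le_opNorm v).trans (mul_le_of_le_one_right (norm_nonneg _) ?_)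
  exact Finset.prod_le_one (fun _ _ => norm_nonneg _) fun i _ => hv i

end MultiIndex

lemma ENNReal.rpow_mul_rpow_le_add (x y : ℝ≥0∞) {θ : ℝ} (h0 : 0 ≤ θ) (h1 : θ ≤ 1) :
    x ^ (1 - θ) * y ^ θ ≤ x + y := by
  have h1' : 0 ≤ 1 - θ := by linarith
  calc x ^ (1 - θ) * y ^ θ ≤ (x + y) ^ (1 - θ) * (x + y) ^ θ := by
        gcongr
        · exact le_self_add
        · exact le_add_self
    _ = x + y := by rw [← ENNReal.rpow_add_of_nonneg _ _ h1' h0]; simp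

lemma SmoothDomain.exists_eLpNorm_mul_iteratedFDeriv_le {n : ℕ} {Ω : Set (Fin n → ℝ)}
    (hΩ : SmoothDomain Ω) {m k : ℕ} (hm : m ≠ 0) (hk : k ≤ m) {q r₁ r₂ s₁ s₂ : ℝ≥0∞}
    (hr₁ : 1 ≤ r₁) (hr₂ : 1 ≤ r₂) (hs₁ : 1 ≤ s₁) (hs₂ : 1 ≤ s₂)
    (h₁ : 1 / q = 1 / r₁ + 1 / s₁) (h₂ : 1 / q = 1 / r₂ + 1 / s₂) :
    ∃ C : ℝ≥0, ∀ f g : (Fin n → ℝ) → ℝ, ContDiff ℝ m f → ContDiff ℝ m g →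
      eLpNorm (fun x => ‖iteratedFDeriv ℝ k f x‖ * ‖iteratedFDeriv ℝ (m - k) g x‖) q
        (volume.restrict Ω) ≤
        C * (LqN r₁ Ω f * WNorm m s₁ Ω g + LqN r₂ Ω g * WNorm m s₂ Ω f) := by
  obtain ⟨C, hC⟩ := hΩ.exists_gagliardo_nirenberg hm hk hr₁ hs₂
  obtain ⟨D, hD⟩ := hΩ.exists_gagliardo_nirenberg hm (Nat.sub_le m k) hr₂ hs₁
  refine ⟨C * D, fun f g hf hg => ?_⟩
  have hT : ENNReal.HolderTriple (interpExp m r₁ s₂ k) (interpExp m r₂ s₁ (m - k)) q :=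
    ⟨interpExp_holder hm hk h₁ h₂⟩
  have hθ0 : (0 : ℝ) ≤ k / m := by positivity
  have hθ1 : (k : ℝ) / m ≤ 1 := div_le_one_of_le₀ (by exact_mod_cast hk) (by positivity)
  have hθ' : ((m - k : ℕ) : ℝ) / m = 1 - k / m := by
    have : (m : ℝ) ≠ 0 := by exact_mod_cast hm
    rw [Nat.cast_sub hk]; field_simp
  have hmul := eLpNorm_smul_le_mul_eLpNorm (p := interpExp m r₁ s₂ k)
    (q := interpExp m r₂ s₁ (m - k)) (r := q) (μ := volume.restrict Ω)
    (continuous_norm_iteratedFDeriv hg (Nat.sub_le m k)).aestronglyMeasurable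
    (continuous_norm_iteratedFDeriv hf hk).aestronglyMeasurable
  rw [eLpNorm_norm, eLpNorm_norm] at hmul
  refine hmul.trans ((mul_le_mul' (hC f hf) (hD g hg)).trans ?_)
  rw [hθ', _root_.sub_sub_cancel]
  refine le_trans (le_of_eq ?_) (mul_le_mul_right
    (ENNReal.rpow_mul_rpow_le_add _ _ hθ0 hθ1) _)
  rw [ENNReal.mul_rpow_of_nonneg _ _ (by linarith), ENNReal.mul_rpow_of_nonneg _ _ hθ0,
    ENNReal.coe_mul]
  ring

/-- **Product estimate in Sobolev spaces on a bounded smooth domain**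
(inequality (2.1) of the paper): for `|α| = m` and exponents satisfying
`1/q = 1/r₁ + 1/s₁ = 1/r₂ + 1/s₂`,
`‖D^α(fg)‖_{L^q} ≤ C(‖f‖_{L^{r₁}}‖g‖_{W^{m,s₁}} + ‖g‖_{L^{r₂}}‖f‖_{W^{m,s₂}})`. -/
theorem sobolev_product_estimate
    (n m : ℕ) (hn : 2 ≤ n) (hm : 1 ≤ m)
    (Ω : Set (Fin n → ℝ)) (hΩ : SmoothDomain Ω)
    (q r1 r2 s1 s2 : ℝ≥0∞)
    (hq : 1 ≤ q) (hr1 : 1 ≤ r1) (hr2 : 1 ≤ r2) (hs1 : 1 ≤ s1) (hs2 : 1 ≤ s2)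
    (hqs1 : 1 / q = 1 / r1 + 1 / s1) (hqs2 : 1 / q = 1 / r2 + 1 / s2) :
    ∃ C : ℝ≥0, 0 < C ∧
      ∀ (α : Fin n → ℕ), mOrder α = m →
        ∀ f g : (Fin n → ℝ) → ℝ, ContDiff ℝ m f → ContDiff ℝ m g →
          LqN q Ω (Dm α fun x => f x * g x)
            ≤ (C : ℝ≥0∞) *
                (LqN r1 Ω f * WNorm m s1 Ω g + LqN r2 Ω g * WNorm m s2 Ω f) := by
  have hm0 : m ≠ 0 := by lia
  have hterm : ∀ k, ∃ C : ℝ≥0, k ≤ m → ∀ f g : (Fin n → ℝ) → ℝ, ContDiff ℝ m f →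
      ContDiff ℝ m g →
      eLpNorm (fun x => ‖iteratedFDeriv ℝ k f x‖ * ‖iteratedFDeriv ℝ (m - k) g x‖) q
        (volume.restrict Ω) ≤
        C * (LqN r1 Ω f * WNorm m s1 Ω g + LqN r2 Ω g * WNorm m s2 Ω f) := by
    intro k
    by_cases hk : k ≤ m
    · obtain ⟨C, hC⟩ := hΩ.exists_eLpNorm_mul_iteratedFDeriv_le hm0 hk hr1 hr2 hs1 hs2 hqs1 hqs2
      exact ⟨C, fun _ => hC⟩
    · exact ⟨0, fun h => absurd h hk⟩
  choose C hC using hterm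
  refine ⟨∑ k ∈ Finset.range (m + 1), m.choose k * C k + 1, by positivity, ?_⟩
  rintro α rfl f g hf hg
  set m := mOrder α
  set R := LqN r1 Ω f * WNorm m s1 Ω g + LqN r2 Ω g * WNorm m s2 Ω f
  have hcont : ∀ k ≤ m, Continuous fun x =>
      ‖iteratedFDeriv ℝ k f x‖ * ‖iteratedFDeriv ℝ (m - k) g x‖ := fun k hk =>
    (continuous_norm_iteratedFDeriv hf hk).mul
      (continuous_norm_iteratedFDeriv hg (Nat.sub_le m k))
  calc LqN q Ω (Dm α fun x => f x * g x)
      ≤ eLpNorm (∑ k ∈ Finset.range (m + 1), fun x => (m.choose k : ℝ) *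
          (‖iteratedFDeriv ℝ k f x‖ * ‖iteratedFDeriv ℝ (m - k) g x‖)) q
          (volume.restrict Ω) := by
        refine eLpNorm_mono_real fun x => ?_
        rw [Finset.sum_apply]
        refine (norm_Dm_le α (hf.mul hg) x).trans
          ((norm_iteratedFDeriv_mul_le hf hg x le_rfl).trans_eq ?_)
        simp only [mul_assoc]
    _ ≤ ∑ k ∈ Finset.range (m + 1), eLpNorm (fun x => (m.choose k : ℝ) *
          (‖iteratedFDeriv ℝ k f x‖ * ‖iteratedFDeriv ℝ (m - k) g x‖)) q
          (volume.restrict Ω) :=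
        eLpNorm_sum_le (fun k hk => (continuous_const.mul (hcont k
          (Nat.lt_succ_iff.1 (Finset.mem_range.1 hk)))).aestronglyMeasurable) hq
    _ ≤ ∑ k ∈ Finset.range (m + 1), (m.choose k * C k : ℝ≥0) * R := by
        refine Finset.sum_le_sum fun k hk => ?_
        refine (eLpNorm_const_smul_le (c := (m.choose k : ℝ))).trans ?_
        rw [ENNReal.coe_mul, mul_assoc]
        refine mul_le_mul' (le_of_eq ?_)
          (hC k (Nat.lt_succ_iff.1 (Finset.mem_range.1 hk)) f g hf hg)
        rw [Real.enorm_eq_ofReal (by positivity), ENNReal.ofReal_natCast, ENNReal.coe_natCast]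
    _ ≤ _ := by
        rw [← Finset.sum_mul, ENNReal.coe_add, ENNReal.ofNNReal_finsetSum]
        gcongr
        exact le_self_add
end
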